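/- arXiv:1107.4142 — 2 statements merged into one kernel-verified Lean document; each statement's English description precedes it below -/
import Mathlib

section
/- Under assumptions (A1)–(A3), fix T > 0 and let s : M_1(Z) → [0,∞) be lower semicontinuous, satisfy the dynamic programming equation, and attain the value 0 at some point ν* ∈ M_1(Z). Then for each ξ ∈ M_1(Z) there exist a path μ̂ : [0,∞) → M_1(Z) and a time-varying rate matrix L̂(t), t ∈ [0,∞), such that μ̂ is absolutely continuous with μ̂̇(t) = −L̂(t)^⊤ μ̂(t) for a.e. t ≥ 0, μ̂(0) = ξ, μ̂(t) ∈ M_1(Z) for all t ≥ 0, and for every integer m ≥ 1: s(ξ) = s(μ̂(mT)) + ∫_0^{mT} Σ_{(i,j)∈E} μ̂(t)(i) λ_{i,j}(μ̂(t)) τ*( l̂_{i,j}(t)/λ_{i,j}(μ̂(t)) − 1 ) dt. -/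
open MeasureTheory Set ENNReal Filter

noncomputable section

/-- The Legendre conjugate `τ*(u) = (u+1)·log(u+1) − u`.  Since `Real.log 0 = 0`
in Mathlib, this gives `τ*(-1) = 1`, matching the convention of the paper; the
value for `u < -1` is irrelevant since all arguments below are `≥ -1`. -/
def tauStar (u : ℝ) : ℝ := (u + 1) * Real.log (u + 1) - u

/-- The mean field model: state space `Fin r`, directed edge set `E` without
self-loops, and transition rate functions `lam i j`, together with assumptions
(A1) (irreducibility), (A2) (Lipschitz rates) and (A3) (rates on edges bounded
below by `c > 0`); `Cb` is the upper bound on the rates (a consequence of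
(A2) and compactness of the simplex). -/
structure MeanFieldModel (r : ℕ) where
  E : Finset (Fin r × Fin r)
  no_diag : ∀ i : Fin r, (i, i) ∉ E
  /-- (A1): the directed graph `(Z, E)` is irreducible. -/
  irreducible : ∀ i j : Fin r, Relation.ReflTransGen (fun a b => (a, b) ∈ E) i j
  lam : Fin r → Fin r → (Fin r → ℝ) → ℝ
  /-- (A2): each rate function is Lipschitz on the simplex. -/
  lam_lipschitz : ∀ p ∈ E, ∃ K : NNReal, LipschitzOnWith K (lam p.1 p.2) (stdSimplex ℝ (Fin r))
  c : ℝ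
  c_pos : 0 < c
  /-- (A3): rates of admissible jumps are uniformly bounded away from zero. -/
  lam_lower : ∀ p ∈ E, ∀ μ ∈ stdSimplex ℝ (Fin r), c ≤ lam p.1 p.2 μ
  /-- rates vanish off the edge set -/
  lam_off : ∀ i j : Fin r, i ≠ j → (i, j) ∉ E → ∀ μ : Fin r → ℝ, lam i j μ = 0
  /-- diagonal convention `λ_{i,i} = −Σ_{j≠i} λ_{i,j}` -/
  lam_diag : ∀ i : Fin r, ∀ μ : Fin r → ℝ,
    lam i i μ = -∑ j ∈ Finset.univ.filter (fun j => j ≠ i), lam i j μ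
  Cb : ℝ
  /-- upper bound on the rates -/
  lam_upper : ∀ p ∈ E, ∀ μ ∈ stdSimplex ℝ (Fin r), lam p.1 p.2 μ ≤ Cb

variable {r : ℕ}

/-- A time-varying rate matrix `L(t)` adapted to the model: measurable entries,
nonnegative off-diagonal entries, entries vanishing off the edge set, and the
diagonal convention `l_{i,i}(t) = −Σ_{j≠i} l_{i,j}(t)`. -/
def IsRateMatrix (M : MeanFieldModel r) (L : ℝ → Fin r → Fin r → ℝ) : Prop :=
  (∀ i j : Fin r, Measurable fun t => L t i j) ∧
  (∀ t : ℝ, ∀ i j : Fin r, i ≠ j → 0 ≤ L t i j) ∧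
  (∀ t : ℝ, ∀ i j : Fin r, i ≠ j → (i, j) ∉ M.E → L t i j = 0) ∧
  (∀ t : ℝ, ∀ i : Fin r,
    L t i i = -∑ j ∈ Finset.univ.filter (fun j => j ≠ i), L t i j)

/-- `μ` is absolutely continuous on `[0,T]` with `μ̇(t) = L(t)ᵀ μ(t)` a.e.,
expressed in integral form:  `μ(t) = μ(0) + ∫_0^t L(s)ᵀ μ(s) ds`. -/
def SolvesODE (L : ℝ → Fin r → Fin r → ℝ) (μ : ℝ → Fin r → ℝ) (T : ℝ) : Prop :=
  (∀ i : Fin r, IntegrableOn (fun t => ∑ j, L t j i * μ t j) (Icc 0 T)) ∧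
  ∀ t ∈ Icc (0 : ℝ) T, ∀ i : Fin r,
    μ t i = μ 0 i + ∫ s in Ioc (0 : ℝ) t, ∑ j, L s j i * μ s j

/-- `μ` is absolutely continuous on `[0,∞)` with `μ̇(t) = −L(t)ᵀ μ(t)` a.e.
(reversed-time dynamics), in integral form. -/
def SolvesReversedODE (L : ℝ → Fin r → Fin r → ℝ) (μ : ℝ → Fin r → ℝ) : Prop :=
  (∀ T : ℝ, 0 < T → ∀ i : Fin r,
    IntegrableOn (fun t => ∑ j, L t j i * μ t j) (Icc 0 T)) ∧
  ∀ t : ℝ, 0 ≤ t → ∀ i : Fin r,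
    μ t i = μ 0 i - ∫ s in Ioc (0 : ℝ) t, ∑ j, L s j i * μ s j

/-- The running cost
`I_{[0,T]}(μ, L) = ∫_0^T Σ_{(i,j)∈E} μ(t)(i) λ_{i,j}(μ(t)) τ*( l_{i,j}(t)/λ_{i,j}(μ(t)) − 1 ) dt`. -/
def runningCost (M : MeanFieldModel r) (μ : ℝ → Fin r → ℝ)
    (L : ℝ → Fin r → Fin r → ℝ) (T : ℝ) : ℝ≥0∞ :=
  ∫⁻ t in Ioc (0 : ℝ) T, ENNReal.ofReal (∑ p ∈ M.E,
    μ t p.1 * M.lam p.1 p.2 (μ t) * tauStar (L t p.1 p.2 / M.lam p.1 p.2 (μ t) - 1))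

/-- The infinite-horizon running cost on `[0, ∞)`. -/
def runningCostInf (M : MeanFieldModel r) (μ : ℝ → Fin r → ℝ)
    (L : ℝ → Fin r → Fin r → ℝ) : ℝ≥0∞ :=
  ∫⁻ t in Ioi (0 : ℝ), ENNReal.ofReal (∑ p ∈ M.E,
    μ t p.1 * M.lam p.1 p.2 (μ t) * tauStar (L t p.1 p.2 / M.lam p.1 p.2 (μ t) - 1))

/-- `S_{[0,T]}(μ | ν)`: the infimum of the running cost over all time-varying
rate matrices `L` with `μ̇ = Lᵀ μ` a.e., provided `μ(0) = ν`, `μ` is absolutely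
continuous and takes values in `M₁(Z)`; `+∞` otherwise (the infimum over an
empty family being `⊤`). -/
def SPath (M : MeanFieldModel r) (T : ℝ) (ν : Fin r → ℝ) (μ : ℝ → Fin r → ℝ) : ℝ≥0∞ :=
  ⨅ (L : ℝ → Fin r → Fin r → ℝ)
    (_ : IsRateMatrix M L ∧ SolvesODE L μ T ∧ μ 0 = ν ∧
      ∀ t ∈ Icc (0 : ℝ) T, μ t ∈ stdSimplex ℝ (Fin r)),
    runningCost M μ L T

/-- `S_T(ξ | ν) = inf { S_{[0,T]}(μ|ν) : μ(0) = ν, μ(T) = ξ }`. -/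
def SEnd (M : MeanFieldModel r) (T : ℝ) (ν ξ : Fin r → ℝ) : ℝ≥0∞ :=
  ⨅ (μ : ℝ → Fin r → ℝ) (_ : μ 0 = ν ∧ μ T = ξ), SPath M T ν μ

/-- The quasipotential `V(ξ | ν) = inf_{T > 0} S_T(ξ | ν)`. -/
def quasipotential (M : MeanFieldModel r) (ν ξ : Fin r → ℝ) : ℝ≥0∞ :=
  ⨅ (T : ℝ) (_ : 0 < T), SEnd M T ν ξ

/-- Equivalence of points: `ν ∼ ξ` iff `V(ξ|ν) = V(ν|ξ) = 0`. -/
def VEquiv (M : MeanFieldModel r) (ν ξ : Fin r → ℝ) : Prop :=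
  quasipotential M ν ξ = 0 ∧ quasipotential M ξ ν = 0

/-- `s` satisfies the dynamic programming equation
`s(ξ) = inf_{ν ∈ M₁(Z)} [ s(ν) + S_T(ξ|ν) ]` for every `T > 0`. -/
def SatisfiesDPE (M : MeanFieldModel r) (s : (Fin r → ℝ) → ℝ) : Prop :=
  ∀ T : ℝ, 0 < T → ∀ ξ ∈ stdSimplex ℝ (Fin r),
    ENNReal.ofReal (s ξ) =
      ⨅ ν ∈ stdSimplex ℝ (Fin r), (ENNReal.ofReal (s ν) + SEnd M T ν ξ)

/-- A solution of the McKean–Vlasov equation `μ̇(t) = A_{μ(t)}ᵀ μ(t)` on `[0,∞)`,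
as a path in `M₁(Z)`, in integral form. -/
def IsMVSolution (M : MeanFieldModel r) (η : ℝ → Fin r → ℝ) : Prop :=
  (∀ t : ℝ, 0 ≤ t → η t ∈ stdSimplex ℝ (Fin r)) ∧
  (∀ T : ℝ, 0 < T → ∀ i : Fin r,
    IntegrableOn (fun t => ∑ j, M.lam j i (η t) * η t j) (Icc 0 T)) ∧
  ∀ t : ℝ, 0 ≤ t → ∀ i : Fin r,
    η t i = η 0 i + ∫ s in Ioc (0 : ℝ) t, ∑ j, M.lam j i (η s) * η s j

/-- A solution of the time-reversed McKean–Vlasov equation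
`η̇(t) = −A_{η(t)}ᵀ η(t)` on `[0,∞)`, in integral form. -/
def IsReversedMVSolution (M : MeanFieldModel r) (η : ℝ → Fin r → ℝ) : Prop :=
  (∀ T : ℝ, 0 < T → ∀ i : Fin r,
    IntegrableOn (fun t => ∑ j, M.lam j i (η t) * η t j) (Icc 0 T)) ∧
  ∀ t : ℝ, 0 ≤ t → ∀ i : Fin r,
    η t i = η 0 i - ∫ s in Ioc (0 : ℝ) t, ∑ j, M.lam j i (η s) * η s j

/-- `ξ₀` is the unique globally asymptotically stable equilibrium of the
McKean–Vlasov equation: `A_{ξ₀}ᵀ ξ₀ = 0` and every solution with initial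
condition in `M₁(Z)` converges to `ξ₀`. -/
def IsUniqueGASEquilibrium (M : MeanFieldModel r) (ξ₀ : Fin r → ℝ) : Prop :=
  ξ₀ ∈ stdSimplex ℝ (Fin r) ∧
  (∀ i : Fin r, ∑ j, M.lam j i ξ₀ * ξ₀ j = 0) ∧
  ∀ η : ℝ → Fin r → ℝ, IsMVSolution M η → Tendsto η atTop (nhds ξ₀)

/-- The ω-limit set of a path: `Ω = ∩_{t>0} closure { μ(t') : t' ≥ t }`. -/
def omegaSet (η : ℝ → Fin r → ℝ) : Set (Fin r → ℝ) :=
  ⋂ t ∈ Ioi (0 : ℝ), closure (η '' Ici t)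

/-- Assumption (B): finitely many compact subsets `K 1, …, K l` of `M₁(Z)` such
that any two points of the same `K i` are equivalent, no point of `K i` is
equivalent to a point of `M₁(Z)` outside `K i`, and every ω-limit set of the
McKean–Vlasov equation is contained in some `K i`. -/
def AssumptionB (M : MeanFieldModel r) (l : ℕ) (K : Fin l → Set (Fin r → ℝ)) : Prop :=
  (∀ i, IsCompact (K i)) ∧
  (∀ i, K i ⊆ stdSimplex ℝ (Fin r)) ∧
  (∀ i, ∀ ν ∈ K i, ∀ ξ ∈ K i, VEquiv M ν ξ) ∧
  (∀ i, ∀ ν ∈ K i, ∀ ξ ∈ stdSimplex ℝ (Fin r), ξ ∉ K i → ¬ VEquiv M ν ξ) ∧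
  (∀ η : ℝ → Fin r → ℝ, IsMVSolution M η → ∃ i, omegaSet η ⊆ K i)

/-- `μ` is continuous and piecewise linear on `[0,T]`, with constant velocity on
each linear segment (linear interpolation between the breakpoints). -/
def PiecewiseLinear (μ : ℝ → Fin r → ℝ) (T : ℝ) : Prop :=
  ∃ (n : ℕ) (t : Fin (n + 1) → ℝ), StrictMono t ∧ t 0 = 0 ∧ t (Fin.last n) = T ∧
    ∀ k : Fin n, ∀ u ∈ Icc (t k.castSucc) (t k.succ), ∀ i : Fin r,
      μ u i = μ (t k.castSucc) i +
        (u - t k.castSucc) / (t k.succ - t k.castSucc) *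
          (μ (t k.succ) i - μ (t k.castSucc) i)

end

open scoped Topology in
theorem ultra_lim_ex (U : Ultrafilter ℕ) (x : ℕ → ℝ≥0∞) : ∃ y, Tendsto x U (𝓝 y) := by
  obtain ⟨y, -, hy⟩ := (isCompact_univ (X := ℝ≥0∞)).ultrafilter_le_nhds (U.map x) (by simp)
  exact ⟨y, hy⟩

open scoped Topology in
theorem dunford_pettis (ρ : Measure ℝ) [IsFiniteMeasure ρ] (U : Ultrafilter ℕ)
    (q : ℕ → ℝ → ℝ≥0∞) (hq : ∀ n, Measurable (q n))
    (K : ℝ≥0∞) (hK : K ≠ ⊤) (hbd : ∀ n, ∫⁻ t, q n t ∂ρ ≤ K)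
    (hui : ∀ ε : ℝ≥0∞, 0 < ε → ∃ δ : ℝ≥0∞, 0 < δ ∧ ∀ n, ∀ A, MeasurableSet A → ρ A < δ →
      ∫⁻ t in A, q n t ∂ρ ≤ ε) :
    ∃ q' : ℝ → ℝ, Measurable q' ∧ (∀ t, 0 ≤ q' t) ∧ ∫⁻ t, ENNReal.ofReal (q' t) ∂ρ ≤ K ∧
      ∀ A, MeasurableSet A →
        Tendsto (fun n => ∫⁻ t in A, q n t ∂ρ) U (𝓝 (∫⁻ t in A, ENNReal.ofReal (q' t) ∂ρ)) := by
  choose m hm using fun A : Set ℝ => ultra_lim_ex U (fun n => ∫⁻ t in A, q n t ∂ρ)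
  have madd : ∀ A B, MeasurableSet B → Disjoint A B → m (A ∪ B) = m A + m B := by
    intro A B hB hAB
    refine tendsto_nhds_unique (hm _) (((hm A).add (hm B)).congr fun n => ?_)
    rw [lintegral_union hB hAB]
  have m0 : m ∅ = 0 := by
    refine tendsto_nhds_unique (hm _) ?_
    simp
  have mle : ∀ A, m A ≤ K := fun A => le_of_tendsto' (hm A) fun n =>
    (setLIntegral_le_lintegral _ _).trans (hbd n)
  have msmall : ∀ ε : ℝ≥0∞, 0 < ε → ∃ δ : ℝ≥0∞, 0 < δ ∧ ∀ A, MeasurableSet A → ρ A < δ →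
      m A ≤ ε := by
    intro ε hε
    obtain ⟨δ, hδ, h⟩ := hui ε hε
    exact ⟨δ, hδ, fun A hA hAδ => le_of_tendsto' (hm A) fun n => h n A hA hAδ⟩
  have mU : ∀ ⦃f : ℕ → Set ℝ⦄, (∀ i, MeasurableSet (f i)) →
        Pairwise (Function.onFun Disjoint f) → m (⋃ i, f i) = ∑' i, m (f i) := by
    intro f hf hd
    let B : ℕ → Set ℝ := fun n => ⋃ i, ⋃ (_ : n ≤ i), f i
    have hB : ∀ n, MeasurableSet (B n) := fun n =>
      MeasurableSet.iUnion fun i => MeasurableSet.iUnion fun _ => hf i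
    have hBs : ∀ n, B n = f n ∪ B (n+1) := by
      intro n; ext x; simp only [B, mem_iUnion, mem_union]
      constructor
      · rintro ⟨i, hi, hx⟩
        rcases hi.eq_or_lt with rfl | h
        · exact Or.inl hx
        · exact Or.inr ⟨i, h, hx⟩
      · rintro (hx | ⟨i, hi, hx⟩)
        · exact ⟨n, le_rfl, hx⟩
        · exact ⟨i, by omega, hx⟩
    have hdis : ∀ n, Disjoint (f n) (B (n+1)) := by
      intro n
      simp only [B, disjoint_iUnion_right]
      intro i hi
      exact hd (by omega)
    have key : ∀ n, m (⋃ i, f i) = ∑ i ∈ Finset.range n, m (f i) + m (B n) := by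
      intro n
      induction n with
      | zero => simp [B]
      | succ n ih =>
        rw [ih, hBs n, madd _ _ (hB _) (hdis n), Finset.sum_range_succ, add_assoc]
    have hρ : Tendsto (fun n => ρ (B n)) atTop (𝓝 0) := by
      have : ⋂ n, B n = ∅ := by
        ext x
        simp only [B, mem_iInter, mem_iUnion, mem_empty_iff_false, iff_false, not_forall]
        by_cases h : ∃ i, x ∈ f i
        · obtain ⟨i, hi⟩ := h
          refine ⟨i+1, ?_⟩
          rintro ⟨j, hj, hx⟩
          exact (Set.disjoint_left.1 (hd (show i ≠ j by omega))) hi hx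
        · exact ⟨0, fun ⟨i, _, hx⟩ => h ⟨i, hx⟩⟩
      have h2 := tendsto_measure_iInter_atTop (μ := ρ) (s := B) (fun n => (hB n).nullMeasurableSet)
        (fun a b hab => by
          intro x; simp only [B, mem_iUnion]
          rintro ⟨i, hi, hx⟩; exact ⟨i, hab.trans hi, hx⟩)
        ⟨0, measure_ne_top _ _⟩
      rw [this, measure_empty] at h2
      exact h2
    have hmB : Tendsto (fun n => m (B n)) atTop (𝓝 0) := by
      rw [ENNReal.tendsto_nhds_zero]
      intro ε hε
      obtain ⟨δ, hδ, h⟩ := msmall ε hε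
      filter_upwards [hρ.eventually (gt_mem_nhds hδ)] with n hn
      exact h _ (hB n) hn
    have h1 : Tendsto (fun n => ∑ i ∈ Finset.range n, m (f i) + m (B n)) atTop
        (𝓝 (∑' i, m (f i) + 0)) := (ENNReal.tendsto_nat_tsum _).add hmB
    rw [add_zero] at h1
    exact tendsto_nhds_unique (tendsto_const_nhds.congr key) h1
  let ν : Measure ℝ := Measure.ofMeasurable (fun A _ => m A) m0 (fun f hf hd => mU hf hd)
  have hν : ∀ A, MeasurableSet A → ν A = m A := fun A hA => Measure.ofMeasurable_apply A hA
  have : IsFiniteMeasure ν := ⟨by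
    rw [hν _ MeasurableSet.univ]; exact (mle _).trans_lt hK.lt_top⟩
  have hac : ν ≪ ρ := by
    refine Measure.AbsolutelyContinuous.mk fun A hA h0 => ?_
    rw [hν A hA]
    refine le_antisymm (le_of_forall_gt_imp_ge_of_dense fun ε hε => ?_) bot_le
    obtain ⟨δ, hδ, h⟩ := msmall ε hε
    exact h A hA (by rw [h0]; exact hδ)
  have hae : (fun t => ENNReal.ofReal (ν.rnDeriv ρ t).toReal) =ᵐ[ρ] ν.rnDeriv ρ := by
    filter_upwards [Measure.rnDeriv_lt_top ν ρ] with t ht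
    exact ENNReal.ofReal_toReal ht.ne
  have hA : ∀ A, MeasurableSet A →
      ∫⁻ t in A, ENNReal.ofReal (ν.rnDeriv ρ t).toReal ∂ρ = m A := by
    intro A hA
    rw [lintegral_congr_ae (ae_restrict_of_ae hae), Measure.setLIntegral_rnDeriv hac, hν A hA]
  refine ⟨fun t => (ν.rnDeriv ρ t).toReal, (Measure.measurable_rnDeriv ν ρ).ennreal_toReal,
    fun t => ENNReal.toReal_nonneg, ?_, ?_⟩
  · rw [← setLIntegral_univ, hA _ MeasurableSet.univ]; exact mle _
  · intro A h
    rw [hA A h]; exact hm A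

theorem fenchel_le (m l lam θ : ℝ) (hm : 0 ≤ m) (hl : 0 ≤ l) (hlam : 0 < lam) :
    θ * (l * m) - m * lam * (Real.exp θ - 1) ≤ m * lam * tauStar (l / lam - 1) := by
  obtain ⟨x, rfl⟩ : ∃ x, l = x * lam := ⟨l / lam, by field_simp⟩
  have hx : 0 ≤ x := nonneg_of_mul_nonneg_left hl hlam
  rw [mul_div_cancel_right₀ _ hlam.ne', tauStar]
  have key : 0 ≤ x * Real.log x - x - θ * x + Real.exp θ := by
    rcases hx.eq_or_lt with rfl | hx
    · simp; positivity
    · have h := Real.add_one_le_exp (θ - Real.log x)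
      rw [Real.exp_sub, Real.exp_log hx, le_div_iff₀ hx] at h
      nlinarith
  have := mul_nonneg (mul_nonneg hm hlam.le) key
  simp only [sub_add_cancel]
  nlinarith

theorem fenchel_sup (m l lam B : ℝ) (hm : 0 ≤ m) (hl : 0 ≤ l) (hlam : 0 < lam)
    (h : ∀ θ : ℝ, θ * (l * m) - m * lam * (Real.exp θ - 1) ≤ B) :
    m * lam * tauStar (l / lam - 1) ≤ B := by
  rcases hl.eq_or_lt with rfl | hl
  · simp [tauStar]
    have ht : Tendsto (fun θ : ℝ => m * lam * (1 - Real.exp θ)) atBot (nhds (m * lam * (1 - 0))) :=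
      (tendsto_const_nhds.sub Real.tendsto_exp_atBot).const_mul _
    simp only [sub_zero, mul_one] at ht
    refine le_of_tendsto' ht fun θ => ?_
    have := h θ
    linarith
  · have h1 := h (Real.log (l / lam))
    rw [Real.exp_log (by positivity)] at h1
    refine le_trans (le_of_eq ?_) h1
    rw [tauStar]
    field_simp
    simp

open scoped Topology in
theorem lsc_edge (ρ : Measure ℝ) [IsFiniteMeasure ρ] (U : Ultrafilter ℕ)
    (q w : ℕ → ℝ → ℝ) (q' w' : ℝ → ℝ)
    (hqi : ∀ n, Integrable (q n) ρ) (hwi : ∀ n, Integrable (w n) ρ)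
    (hqi' : Integrable q' ρ) (hwi' : Integrable w' ρ)
    (hqm' : Measurable q') (hwm' : Measurable w')
    (hq : ∀ A, MeasurableSet A → Tendsto (fun n => ∫ t in A, q n t ∂ρ) U (𝓝 (∫ t in A, q' t ∂ρ)))
    (hw : ∀ A, MeasurableSet A → Tendsto (fun n => ∫ t in A, w n t ∂ρ) U (𝓝 (∫ t in A, w' t ∂ρ)))
    (f : ℕ → ℝ → ℝ≥0∞) (hf : ∀ n, ∀ θ : ℝ, ∀ t,
      ENNReal.ofReal (θ * q n t - w n t * (Real.exp θ - 1)) ≤ f n t)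
    (c : ℝ≥0∞) (hc : Tendsto (fun n => ∫⁻ t, f n t ∂ρ) U (𝓝 c)) :
    ∫⁻ t, (⨆ θ : ℚ, ENNReal.ofReal (θ * q' t - w' t * (Real.exp θ - 1))) ∂ρ ≤ c := by
  choose m hm using fun A : Set ℝ => ultra_lim_ex U (fun n => ∫⁻ t in A, f n t ∂ρ)
  have madd : ∀ A B, MeasurableSet B → Disjoint A B → m (A ∪ B) = m A + m B := by
    intro A B hB hAB
    refine tendsto_nhds_unique (hm _) (((hm A).add (hm B)).congr fun n => ?_)
    rw [lintegral_union hB hAB]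
  have mmono : ∀ A B, A ⊆ B → m A ≤ m B := fun A B hAB =>
    le_of_tendsto_of_tendsto' (hm A) (hm B) fun n => lintegral_mono_set hAB
  have step1 : ∀ θ : ℝ, ∀ A, MeasurableSet A →
      ∫⁻ t in A, ENNReal.ofReal (θ * q' t - w' t * (Real.exp θ - 1)) ∂ρ ≤ m A := by
    intro θ A hA
    set g : ℝ → ℝ := fun t => θ * q' t - w' t * (Real.exp θ - 1) with hg
    have hgm : Measurable g := (hqm'.const_mul _).sub (hwm'.mul_const _)
    have hgi : Integrable g ρ := (hqi'.const_mul _).sub (hwi'.mul_const _)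
    have hgin : ∀ n, Integrable (fun t => θ * q n t - w n t * (Real.exp θ - 1)) ρ :=
      fun n => ((hqi n).const_mul _).sub ((hwi n).mul_const _)
    have hP : MeasurableSet {t | 0 ≤ g t} := measurableSet_le measurable_const hgm
    have e1 : ∫⁻ t in A, ENNReal.ofReal (g t) ∂ρ
        = ∫⁻ t in A ∩ {t | 0 ≤ g t}, ENNReal.ofReal (g t) ∂ρ := by
      rw [← lintegral_inter_add_sdiff (fun t => ENNReal.ofReal (g t)) A hP]
      have : ∫⁻ t in A \ {t | 0 ≤ g t}, ENNReal.ofReal (g t) ∂ρ = 0 := by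
        rw [setLIntegral_congr_fun (g := fun _ => 0) (hA.diff hP)]
        · simp
        · intro t ht
          have : ¬ 0 ≤ g t := ht.2
          simp only [ENNReal.ofReal_eq_zero]; linarith
      rw [this, add_zero]
    rw [e1]
    refine le_trans ?_ (mmono (A ∩ {t | 0 ≤ g t}) A inter_subset_left)
    set A' := A ∩ {t | 0 ≤ g t} with hA'
    have hA'm : MeasurableSet A' := hA.inter hP
    rw [← ofReal_integral_eq_lintegral_ofReal hgi.restrict]
    · have e2 : ∫ t in A', g t ∂ρ = θ * ∫ t in A', q' t ∂ρ
          - (∫ t in A', w' t ∂ρ) * (Real.exp θ - 1) := by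
        rw [hg, integral_sub (hqi'.restrict.const_mul _) (hwi'.restrict.mul_const _),
          integral_const_mul, integral_mul_const]
      rw [e2]
      have ht := ENNReal.tendsto_ofReal
        (((hq A' hA'm).const_mul θ).sub ((hw A' hA'm).mul_const (Real.exp θ - 1)))
      refine le_of_tendsto_of_tendsto' ht (hm A') fun n => ?_
      rw [← integral_const_mul, ← integral_mul_const,
        ← integral_sub ((hqi n).restrict.const_mul _) ((hwi n).restrict.mul_const _)]
      rw [integral_eq_lintegral_pos_part_sub_lintegral_neg_part (hgin n).restrict]
      refine le_trans (ENNReal.ofReal_le_ofReal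
        (sub_le_self _ ENNReal.toReal_nonneg)) (ENNReal.ofReal_toReal_le.trans ?_)
      exact lintegral_mono fun t => hf n θ t
    · filter_upwards [ae_restrict_mem hA'm] with t ht using ht.2
  obtain ⟨e, he⟩ := exists_surjective_nat ℚ
  set h : ℕ → ℝ → ℝ≥0∞ := fun k t =>
    ENNReal.ofReal ((e k : ℝ) * q' t - w' t * (Real.exp (e k : ℝ) - 1)) with hh
  have hhm : ∀ k, Measurable (h k) := fun k =>
    ((hqm'.const_mul _).sub (hwm'.mul_const _)).ennreal_ofReal
  have hpm : ∀ k, Measurable (partialSups h k) := by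
    intro k
    induction k with
    | zero => simpa using hhm 0
    | succ k ih => rw [partialSups_add_one]; exact ih.sup (hhm _)
  have step2 : ∀ k, ∀ A, MeasurableSet A → ∫⁻ t in A, partialSups h k t ∂ρ ≤ m A := by
    intro k
    induction k with
    | zero => intro A hA; simpa using step1 (e 0) A hA
    | succ k ih =>
      intro A hA
      have hS : MeasurableSet {t | partialSups h k t ≤ h (k+1) t} :=
        measurableSet_le (hpm k) (hhm _)
      rw [← lintegral_inter_add_sdiff (fun t => partialSups h (k+1) t) A hS,
        ← Set.inter_union_sdiff A {t | partialSups h k t ≤ h (k+1) t},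
        madd _ _ (hA.diff hS) (Set.disjoint_sdiff_inter.symm), Set.inter_union_sdiff]
      refine add_le_add ?_ ?_
      · refine le_trans (le_of_eq ?_) (step1 (e (k+1)) _ (hA.inter hS))
        refine setLIntegral_congr_fun (hA.inter hS) fun t ht => ?_
        simp only [partialSups_add_one, Pi.sup_apply]
        exact sup_eq_right.2 ht.2
      · refine le_trans (le_of_eq ?_) (ih _ (hA.diff hS))
        refine setLIntegral_congr_fun (hA.diff hS) fun t ht => ?_
        simp only [partialSups_add_one, Pi.sup_apply]
        exact sup_eq_left.2 (not_le.1 ht.2).le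
  have e3 : ∀ t, (⨆ θ : ℚ, ENNReal.ofReal (θ * q' t - w' t * (Real.exp θ - 1)))
      = ⨆ k, partialSups h k t := by
    intro t
    rw [← he.iSup_comp]
    have := congrFun (iSup_partialSups_eq h) t
    rw [iSup_apply, iSup_apply] at this
    exact this.symm
  simp_rw [e3]
  rw [lintegral_iSup hpm (fun a b hab => (partialSups h).monotone hab)]
  refine iSup_le fun k => ?_
  have := step2 k univ MeasurableSet.univ
  rw [setLIntegral_univ] at this
  refine this.trans (le_of_eq (tendsto_nhds_unique (hm univ) ?_))
  simpa using hc

/-- incidence sign of an edge at a vertex -/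
noncomputable def sg {r : ℕ} (p : Fin r × Fin r) (i : Fin r) : ℝ :=
  (if p.2 = i then 1 else 0) - (if p.1 = i then 1 else 0)

theorem flux_sum {r : ℕ} (M : MeanFieldModel r) (L : ℝ → Fin r → Fin r → ℝ)
    (hL : IsRateMatrix M L) (t : ℝ) (m : Fin r → ℝ) (i : Fin r) :
    ∑ j, L t j i * m j = ∑ p ∈ M.E, sg p i * (L t p.1 p.2 * m p.1) := by
  obtain ⟨-, -, hoff, hdiag⟩ := hL
  have h1 : ∑ p ∈ M.E, sg p i * (L t p.1 p.2 * m p.1)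
      = ∑ p : Fin r × Fin r, (if p.1 = p.2 then 0 else sg p i * (L t p.1 p.2 * m p.1)) := by
    rw [← Finset.sum_subset (Finset.subset_univ M.E)]
    · refine Finset.sum_congr rfl fun p hp => ?_
      rw [if_neg]
      intro h
      apply M.no_diag p.1
      have : p = (p.1, p.1) := Prod.ext rfl h.symm
      rwa [this] at hp
    · intro p _ hp
      split_ifs with h
      · rfl
      · rw [hoff t p.1 p.2 h hp]; ring
  rw [h1, Fintype.sum_prod_type]
  have h2 : ∀ a b : Fin r, (if a = b then (0:ℝ) else sg (a, b) i * (L t a b * m a))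
      = (if b = i then (if a = i then 0 else L t a i * m a) else 0)
        - (if a = i then (if b = i then 0 else L t i b * m i) else 0) := by
    intro a b
    by_cases hb : b = i
    · subst hb
      by_cases ha : a = b
      · simp [ha]
      · simp [ha, sg]
    · by_cases ha : a = i
      · subst ha
        simp [hb, Ne.symm hb, sg]
      · simp [ha, hb, sg]
  simp only [h2, Finset.sum_sub_distrib]
  have h3 : ∑ a, ∑ b, (if a = i then (if b = i then 0 else L t i b * m i) else 0)
      = - (L t i i * m i) := by
    rw [Finset.sum_comm]
    simp only [Finset.sum_ite_eq', Finset.mem_univ, if_true]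
    rw [hdiag t i, neg_mul, neg_neg, Finset.sum_mul, Finset.sum_filter]
    refine Finset.sum_congr rfl fun b _ => ?_
    by_cases hb : b = i <;> simp [hb]
  rw [h3]
  simp only [Finset.sum_ite_eq', Finset.mem_univ, if_true]
  rw [sub_neg_eq_add]
  rw [← Finset.add_sum_erase _ _ (Finset.mem_univ i), add_comm,
    ← Finset.add_sum_erase (a := i) (f := fun a => if a = i then 0 else L t a i * m a) _
      (Finset.mem_univ i)]
  simp only [if_true, zero_add]
  congr 1
  refine Finset.sum_congr rfl fun b hb => ?_
  rw [if_neg (Finset.ne_of_mem_erase hb)]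

theorem SolvesODE.continuousOn {r : ℕ} {L : ℝ → Fin r → Fin r → ℝ} {μ : ℝ → Fin r → ℝ} {T : ℝ}
    (h : SolvesODE L μ T) : ContinuousOn μ (Icc 0 T) := by
  rw [continuousOn_pi]
  intro i
  have := (intervalIntegral.continuousOn_primitive (h.1 i)).const_add (μ 0 i)
  exact this.congr fun t ht => h.2 t ht i

theorem good_traj {r : ℕ} (M : MeanFieldModel r) (L : ℝ → Fin r → Fin r → ℝ)
    (μ : ℝ → Fin r → ℝ) (T : ℝ) (hT : 0 < T)
    (hode : SolvesODE L μ T) (hsim : ∀ t ∈ Icc (0:ℝ) T, μ t ∈ stdSimplex ℝ (Fin r)) :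
    ∃ μ' : ℝ → Fin r → ℝ, Continuous μ' ∧ (∀ t, μ' t ∈ stdSimplex ℝ (Fin r)) ∧
      μ' 0 = μ 0 ∧ μ' T = μ T ∧ runningCost M μ' L T = runningCost M μ L T ∧
      SolvesODE L μ' T := by
  have heq : ∀ t ∈ Icc (0:ℝ) T, IccExtend hT.le ((Icc 0 T).domRestrict μ) t = μ t := by
    intro t ht
    rw [IccExtend_of_mem _ _ ht]; rfl
  refine ⟨IccExtend hT.le ((Icc 0 T).domRestrict μ), ?_, ?_, ?_, ?_, ?_, ?_, ?_⟩
  · exact (continuousOn_iff_continuous_domRestrict.1 hode.continuousOn).Icc_extend'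
  · intro t
    exact hsim _ (projIcc 0 T hT.le t).2
  · exact heq 0 (by simp [hT.le])
  · exact heq T (by simp [hT.le])
  · refine setLIntegral_congr_fun measurableSet_Ioc fun t ht => ?_
    simp only [heq t (Ioc_subset_Icc_self ht)]
  · intro i
    refine (hode.1 i).congr_fun (fun t ht => ?_) measurableSet_Icc
    simp only [heq t ht]
  · intro t ht i
    rw [heq t ht, heq 0 (by simp [hT.le]), hode.2 t ht i]
    congr 1
    refine setIntegral_congr_fun measurableSet_Ioc fun u hu => ?_
    simp only [heq u ⟨hu.1.le, hu.2.trans ht.2⟩]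

/-- cost of an edge -/
noncomputable def ecost {r : ℕ} (M : MeanFieldModel r) (μ : ℝ → Fin r → ℝ)
    (L : ℝ → Fin r → Fin r → ℝ) (p : Fin r × Fin r) (t : ℝ) : ℝ :=
  μ t p.1 * M.lam p.1 p.2 (μ t) * tauStar (L t p.1 p.2 / M.lam p.1 p.2 (μ t) - 1)

theorem off_diag {r : ℕ} (M : MeanFieldModel r) {p : Fin r × Fin r} (hp : p ∈ M.E) :
    p.1 ≠ p.2 := by
  intro h
  apply M.no_diag p.1
  have : p = (p.1, p.1) := Prod.ext rfl h.symm
  rwa [this] at hp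

theorem lam_cont {r : ℕ} (M : MeanFieldModel r) {p : Fin r × Fin r} (hp : p ∈ M.E)
    (μ : ℝ → Fin r → ℝ) (hμ : Continuous μ) (hs : ∀ t, μ t ∈ stdSimplex ℝ (Fin r)) :
    Continuous fun t => M.lam p.1 p.2 (μ t) := by
  obtain ⟨K, hK⟩ := M.lam_lipschitz p hp
  exact hK.continuousOn.comp_continuous hμ hs

theorem ecost_fenchel {r : ℕ} (M : MeanFieldModel r) {p : Fin r × Fin r} (hp : p ∈ M.E)
    (μ : ℝ → Fin r → ℝ) (L : ℝ → Fin r → Fin r → ℝ) (hL : IsRateMatrix M L) (t : ℝ)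
    (hs : μ t ∈ stdSimplex ℝ (Fin r)) (θ : ℝ) :
    θ * (L t p.1 p.2 * μ t p.1) - μ t p.1 * M.lam p.1 p.2 (μ t) * (Real.exp θ - 1)
      ≤ ecost M μ L p t :=
  fenchel_le _ _ _ _ (hs.1 _) (hL.2.1 t _ _ (off_diag M hp))
    (M.c_pos.trans_le (M.lam_lower p hp _ hs))

theorem ecost_nonneg {r : ℕ} (M : MeanFieldModel r) {p : Fin r × Fin r} (hp : p ∈ M.E)
    (μ : ℝ → Fin r → ℝ) (L : ℝ → Fin r → Fin r → ℝ) (hL : IsRateMatrix M L) (t : ℝ)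
    (hs : μ t ∈ stdSimplex ℝ (Fin r)) : 0 ≤ ecost M μ L p t := by
  simpa using ecost_fenchel M hp μ L hL t hs 0

theorem ecost_meas {r : ℕ} (M : MeanFieldModel r) {p : Fin r × Fin r} (hp : p ∈ M.E)
    (μ : ℝ → Fin r → ℝ) (L : ℝ → Fin r → Fin r → ℝ) (hL : IsRateMatrix M L)
    (hμ : Continuous μ) (hs : ∀ t, μ t ∈ stdSimplex ℝ (Fin r)) :
    Measurable (ecost M μ L p) := by
  have h1 := (lam_cont M hp μ hμ hs).measurable
  have h2 : Measurable fun t => μ t p.1 := ((continuous_apply _).comp hμ).measurable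
  have h3 : Measurable fun t => L t p.1 p.2 / M.lam p.1 p.2 (μ t) - 1 + 1 :=
    (((hL.1 p.1 p.2).div h1).sub_const 1).add_const 1
  have h4 : Measurable fun t => L t p.1 p.2 / M.lam p.1 p.2 (μ t) - 1 :=
    (((hL.1 p.1 p.2).div h1).sub_const 1)
  exact (h2.mul h1).mul ((h3.mul h3.log).sub h4)

theorem runningCost_eq {r : ℕ} (M : MeanFieldModel r)
    (μ : ℝ → Fin r → ℝ) (L : ℝ → Fin r → Fin r → ℝ) (hL : IsRateMatrix M L)
    (hμ : Continuous μ) (hs : ∀ t, μ t ∈ stdSimplex ℝ (Fin r)) (T : ℝ) :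
    runningCost M μ L T =
      ∑ p ∈ M.E, ∫⁻ t in Ioc 0 T, ENNReal.ofReal (ecost M μ L p t) := by
  rw [← lintegral_finsetSum' _ fun p hp =>
    (ecost_meas M hp μ L hL hμ hs).ennreal_ofReal.aemeasurable, runningCost]
  refine lintegral_congr fun t => ?_
  rw [ENNReal.ofReal_sum_of_nonneg]
  · rfl
  · exact fun p hp => ecost_nonneg M hp μ L hL t (hs t)

theorem flux_bound {r : ℕ} (M : MeanFieldModel r) {p : Fin r × Fin r} (hp : p ∈ M.E)
    (μ : ℝ → Fin r → ℝ) (L : ℝ → Fin r → Fin r → ℝ) (hL : IsRateMatrix M L)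
    (hμ : Continuous μ) (hs : ∀ t, μ t ∈ stdSimplex ℝ (Fin r)) (T θ : ℝ) (hθ : 0 < θ)
    (A : Set ℝ) :
    ENNReal.ofReal θ * ∫⁻ t in A, ENNReal.ofReal (L t p.1 p.2 * μ t p.1) ∂(volume.restrict (Ioc 0 T))
      ≤ runningCost M μ L T +
        ENNReal.ofReal (M.Cb * Real.exp θ) * (volume.restrict (Ioc 0 T)) A := by
  rw [← lintegral_const_mul']
  swap; · exact ENNReal.ofReal_ne_top
  have : ∀ t, ENNReal.ofReal θ * ENNReal.ofReal (L t p.1 p.2 * μ t p.1) ≤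
      ENNReal.ofReal (ecost M μ L p t) + ENNReal.ofReal (M.Cb * Real.exp θ) := by
    intro t
    have h1 := ecost_fenchel M hp μ L hL t (hs t) θ
    have h2 := M.lam_upper p hp _ (hs t)
    have h3 := M.c_pos.trans_le (M.lam_lower p hp _ (hs t))
    have h4 := ecost_nonneg M hp μ L hL t (hs t)
    have h5 : μ t p.1 ≤ 1 := by
      rw [← (hs t).2]
      exact Finset.single_le_sum (fun i _ => (hs t).1 i) (Finset.mem_univ _)
    have h6 := (hs t).1 p.1
    have h7 : 1 ≤ Real.exp θ := Real.one_le_exp hθ.le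
    have hCb : 0 < M.Cb := h3.trans_le h2
    have h8 : 0 ≤ M.Cb * Real.exp θ := by positivity
    rw [← ENNReal.ofReal_mul hθ.le, ← ENNReal.ofReal_add h4 h8]
    refine ENNReal.ofReal_le_ofReal ?_
    have h9 : μ t p.1 * M.lam p.1 p.2 (μ t) * (Real.exp θ - 1) ≤ M.Cb * Real.exp θ := by
      have : μ t p.1 * M.lam p.1 p.2 (μ t) ≤ M.Cb := by nlinarith
      have h0 : 0 ≤ μ t p.1 * M.lam p.1 p.2 (μ t) := by positivity
      exact mul_le_mul this (by linarith) (by linarith) (h0.trans this)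
    linarith
  refine (lintegral_mono this).trans ?_
  rw [lintegral_add_right _ measurable_const, lintegral_const, Measure.restrict_apply_univ]
  gcongr
  refine (setLIntegral_le_lintegral _ _).trans ?_
  rw [runningCost_eq M μ L hL hμ hs]
  exact Finset.single_le_sum (f := fun p => ∫⁻ t in Ioc 0 T, ENNReal.ofReal (ecost M μ L p t))
    (fun _ _ => bot_le) hp

theorem flux_ui {r : ℕ} (M : MeanFieldModel r) {p : Fin r × Fin r} (hp : p ∈ M.E)
    (T : ℝ) (μ : ℕ → ℝ → Fin r → ℝ) (L : ℕ → ℝ → Fin r → Fin r → ℝ)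
    (hL : ∀ n, IsRateMatrix M (L n))
    (hμ : ∀ n, Continuous (μ n)) (hs : ∀ n t, μ n t ∈ stdSimplex ℝ (Fin r))
    (K : ℝ) (hK0 : 0 ≤ K) (hK : ∀ n, runningCost M (μ n) (L n) T ≤ ENNReal.ofReal K)
    (ε : ℝ) (hε : 0 < ε) : ∃ δ : ℝ, 0 < δ ∧ ∀ n, ∀ A,
      (volume.restrict (Ioc 0 T)) A < ENNReal.ofReal δ →
      ∫⁻ t in A, ENNReal.ofReal (L n t p.1 p.2 * μ n t p.1) ∂(volume.restrict (Ioc 0 T))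
        ≤ ENNReal.ofReal ε := by
  have hCb : 0 < M.Cb := (M.c_pos.trans_le (M.lam_lower p hp _ (hs 0 0))).trans_le
    (M.lam_upper p hp _ (hs 0 0))
  set θ := (K + 1) / ε with hθd
  have hθ : 0 < θ := by positivity
  refine ⟨1 / (M.Cb * Real.exp θ), by positivity, fun n A hA => ?_⟩
  have h := flux_bound M hp (μ n) (L n) (hL n) (hμ n) (hs n) T θ hθ A
  have h2 : ENNReal.ofReal θ * ∫⁻ t in A, ENNReal.ofReal (L n t p.1 p.2 * μ n t p.1)
      ∂(volume.restrict (Ioc 0 T)) ≤ ENNReal.ofReal θ * ENNReal.ofReal ε := by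
    refine h.trans ((add_le_add (hK n) (mul_le_mul_right hA.le _)).trans (le_of_eq ?_))
    rw [← ENNReal.ofReal_mul (by positivity), ← ENNReal.ofReal_add hK0 (by positivity),
      ← ENNReal.ofReal_mul hθ.le]
    congr 1
    rw [hθd]
    field_simp
  exact (ENNReal.mul_le_mul_iff_right (by simpa using hθ) ENNReal.ofReal_ne_top).1 h2

theorem flux_integrable {r : ℕ} (M : MeanFieldModel r) {p : Fin r × Fin r} (hp : p ∈ M.E)
    (T : ℝ) (μ : ℝ → Fin r → ℝ) (L : ℝ → Fin r → Fin r → ℝ)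
    (hL : IsRateMatrix M L)
    (hμ : Continuous μ) (hs : ∀ t, μ t ∈ stdSimplex ℝ (Fin r))
    (hK : runningCost M μ L T ≠ ⊤) :
    Integrable (fun t => L t p.1 p.2 * μ t p.1) (volume.restrict (Ioc 0 T)) := by
  have hm : Measurable fun t => L t p.1 p.2 * μ t p.1 :=
    (hL.1 _ _).mul ((continuous_apply _).comp hμ).measurable
  refine ⟨hm.aestronglyMeasurable, ?_⟩
  rw [hasFiniteIntegral_iff_ofReal (ae_of_all _ fun t =>
    mul_nonneg (hL.2.1 t _ _ (off_diag M hp)) ((hs t).1 _))]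
  have h := flux_bound M hp μ L hL hμ hs T 1 one_pos univ
  rw [setLIntegral_univ, ENNReal.ofReal_one, one_mul] at h
  refine h.trans_lt (ENNReal.add_lt_top.2 ⟨hK.lt_top, ENNReal.mul_lt_top ENNReal.ofReal_lt_top
    (measure_lt_top _ _)⟩)

theorem setInt_restrict {T t : ℝ} (u : ℝ) (hu : 0 ≤ u) (ht : t ≤ T) (f : ℝ → ℝ) :
    ∫ x in Ioc u t, f x ∂(volume.restrict (Ioc 0 T)) = ∫ x in Ioc u t, f x := by
  rw [Measure.restrict_restrict measurableSet_Ioc,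
    inter_eq_left.2 (Ioc_subset_Ioc hu ht)]

/-- the trajectory in terms of fluxes -/
theorem traj_flux {r : ℕ} (M : MeanFieldModel r)
    (T : ℝ) (μ : ℝ → Fin r → ℝ) (L : ℝ → Fin r → Fin r → ℝ)
    (hL : IsRateMatrix M L)
    (hμ : Continuous μ) (hs : ∀ t, μ t ∈ stdSimplex ℝ (Fin r))
    (hK : runningCost M μ L T ≠ ⊤) (hode : SolvesODE L μ T) (t : ℝ) (ht : t ∈ Icc 0 T)
    (i : Fin r) :
    μ t i = μ 0 i + ∑ p ∈ M.E, sg p i *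
      ∫ u in Ioc 0 t, L u p.1 p.2 * μ u p.1 ∂(volume.restrict (Ioc 0 T)) := by
  rw [hode.2 t ht i]
  congr 1
  simp_rw [flux_sum M L hL]
  rw [← setInt_restrict 0 le_rfl ht.2, integral_finsetSum]
  · simp_rw [integral_const_mul]
  · exact fun p hp => ((flux_integrable M hp T μ L hL hμ hs hK).restrict).const_mul _

theorem sg_abs {r : ℕ} (p : Fin r × Fin r) (i : Fin r) : |sg p i| ≤ 1 := by
  unfold sg; split_ifs <;> simp

theorem traj_equi {r : ℕ} (M : MeanFieldModel r)
    (T : ℝ) (μ : ℕ → ℝ → Fin r → ℝ) (L : ℕ → ℝ → Fin r → Fin r → ℝ)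
    (hL : ∀ n, IsRateMatrix M (L n))
    (hμ : ∀ n, Continuous (μ n)) (hs : ∀ n t, μ n t ∈ stdSimplex ℝ (Fin r))
    (K : ℝ) (hK0 : 0 ≤ K) (hK : ∀ n, runningCost M (μ n) (L n) T ≤ ENNReal.ofReal K)
    (hode : ∀ n, SolvesODE (L n) (μ n) T) (ε : ℝ) (hε : 0 < ε) :
    ∃ δ : ℝ, 0 < δ ∧ ∀ n, ∀ u ∈ Icc 0 T, ∀ t ∈ Icc 0 T, |t - u| < δ →
      dist (μ n t) (μ n u) ≤ ε := by
  set ε' := ε / (M.E.card + 1) with hε'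
  have hε'0 : 0 < ε' := by positivity
  have h1 : ∀ p, ∃ δ : ℝ, 0 < δ ∧ (p ∈ M.E → ∀ n, ∀ A,
      (volume.restrict (Ioc 0 T)) A < ENNReal.ofReal δ →
      ∫⁻ t in A, ENNReal.ofReal (L n t p.1 p.2 * μ n t p.1) ∂(volume.restrict (Ioc 0 T))
        ≤ ENNReal.ofReal ε') := by
    intro p
    by_cases hp : p ∈ M.E
    · obtain ⟨δ, h, h'⟩ := flux_ui M hp T μ L hL hμ hs K hK0 hK ε' hε'0
      exact ⟨δ, h, fun _ => h'⟩
    · exact ⟨1, one_pos, fun h => absurd h hp⟩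
  choose δ hδ hδ' using h1
  obtain ⟨d, hd, hd'⟩ : ∃ d : ℝ, 0 < d ∧ ∀ p, d ≤ δ p := by
    by_cases hne : Nonempty (Fin r × Fin r)
    · obtain ⟨p, hp⟩ := Finite.exists_min δ
      exact ⟨δ p, hδ p, hp⟩
    · exact ⟨1, one_pos, fun p => absurd ⟨p⟩ hne⟩
  have key : ∀ n, ∀ u ∈ Icc 0 T, ∀ t ∈ Icc 0 T, u ≤ t → |t - u| < d →
      dist (μ n t) (μ n u) ≤ ε := by
    intro n u hu t ht hut hd2
    have hfin : runningCost M (μ n) (L n) T ≠ ⊤ := ((hK n).trans_lt ENNReal.ofReal_lt_top).ne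
    rw [dist_pi_le_iff hε.le]
    intro i
    rw [Real.dist_eq, traj_flux M T _ _ (hL n) (hμ n) (hs n) hfin (hode n) t ht i,
      traj_flux M T _ _ (hL n) (hμ n) (hs n) hfin (hode n) u hu i, add_sub_add_left_eq_sub,
      ← Finset.sum_sub_distrib]
    refine (Finset.abs_sum_le_sum_abs _ _).trans ((Finset.sum_le_card_nsmul _ _ ε' ?_).trans ?_)
    · intro p hp
      have hi := flux_integrable M hp T _ _ (hL n) (hμ n) (hs n) hfin
      rw [← mul_sub, abs_mul, ← Ioc_union_Ioc_eq_Ioc hu.1 hut,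
        setIntegral_union (Ioc_disjoint_Ioc_of_le le_rfl) measurableSet_Ioc hi.restrict hi.restrict,
        add_sub_cancel_left]
      refine (mul_le_of_le_one_left (abs_nonneg _) (sg_abs p i)).trans ?_
      have hnn : ∀ t, 0 ≤ L n t p.1 p.2 * μ n t p.1 := fun t =>
        mul_nonneg ((hL n).2.1 t _ _ (off_diag M hp)) ((hs n t).1 _)
      rw [abs_of_nonneg (integral_nonneg hnn),
        integral_eq_lintegral_of_nonneg_ae (ae_of_all _ hnn) hi.restrict.aestronglyMeasurable]
      refine ENNReal.toReal_le_of_le_ofReal hε'0.le (hδ' p hp n _ ?_)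
      refine lt_of_le_of_lt (Measure.restrict_apply_le _ _) ?_
      rw [Real.volume_Ioc]
      refine (ENNReal.ofReal_lt_ofReal_iff (hδ p)).2 ?_
      exact ((le_abs_self _).trans_lt hd2).trans_le (hd' p)
    · rw [nsmul_eq_mul, hε']
      have : (0:ℝ) ≤ M.E.card := by positivity
      rw [← mul_div_assoc, div_le_iff₀ (by positivity)]
      nlinarith
  refine ⟨d, hd, fun n u hu t ht h => ?_⟩
  rcases le_total u t with h1 | h1
  · exact key n u hu t ht h1 h
  · rw [dist_comm]; exact key n t ht u hu h1 (by rwa [abs_sub_comm])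

open scoped Topology in
theorem traj_unif {r : ℕ} (T : ℝ) (U : Ultrafilter ℕ) (μ : ℕ → ℝ → Fin r → ℝ)
    (μ' : ℝ → Fin r → ℝ)
    (heq : ∀ ε : ℝ, 0 < ε → ∃ δ : ℝ, 0 < δ ∧ ∀ n, ∀ u ∈ Icc 0 T, ∀ t ∈ Icc 0 T, |t - u| < δ →
      dist (μ n t) (μ n u) ≤ ε)
    (hlim : ∀ t ∈ Icc 0 T, Tendsto (fun n => μ n t) U (𝓝 (μ' t))) :
    TendstoUniformlyOn μ μ' U (Icc 0 T) := by
  rw [← tendstoLocallyUniformlyOn_iff_tendstoUniformlyOn_of_compact isCompact_Icc,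
    Metric.tendstoLocallyUniformlyOn_iff]
  intro ε hε t ht
  obtain ⟨δ, hδ, h⟩ := heq (ε / 4) (by positivity)
  refine ⟨Metric.ball t δ ∩ Icc 0 T, 
    Filter.inter_mem (mem_nhdsWithin_of_mem_nhds (Metric.ball_mem_nhds t hδ))
      self_mem_nhdsWithin, ?_⟩
  have := (Metric.tendsto_nhds.1 (hlim t ht)) (ε/4) (by positivity)
  filter_upwards [this] with n hn u hu
  have h1 : ∀ k, dist (μ k u) (μ k t) ≤ ε / 4 := fun k => h k t ht u hu.2 hu.1
  have h2 : dist (μ' u) (μ' t) ≤ ε / 4 :=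
    le_of_tendsto' ((hlim u hu.2).dist (hlim t ht)) h1
  calc dist (μ' u) (μ n u) ≤ dist (μ' u) (μ' t) + dist (μ' t) (μ n t) + dist (μ n t) (μ n u) :=
        dist_triangle4 _ _ _ _
    _ < ε := by
      have := h1 n
      rw [dist_comm] at hn this
      linarith

open scoped Topology in
theorem weight_lim {r : ℕ} (M : MeanFieldModel r) {p : Fin r × Fin r} (hp : p ∈ M.E)
    (T : ℝ) (U : Ultrafilter ℕ) (μ : ℕ → ℝ → Fin r → ℝ) (μ' : ℝ → Fin r → ℝ)
    (hμ : ∀ n, Continuous (μ n)) (hs : ∀ n t, μ n t ∈ stdSimplex ℝ (Fin r))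
    (hμ' : Continuous μ') (hs' : ∀ t, μ' t ∈ stdSimplex ℝ (Fin r))
    (hu : TendstoUniformlyOn μ μ' U (Icc 0 T)) (A : Set ℝ) :
    Tendsto (fun n => ∫ t in A, μ n t p.1 * M.lam p.1 p.2 (μ n t) ∂(volume.restrict (Ioc 0 T)))
      U (𝓝 (∫ t in A, μ' t p.1 * M.lam p.1 p.2 (μ' t) ∂(volume.restrict (Ioc 0 T)))) := by
  obtain ⟨K, hK⟩ := M.lam_lipschitz p hp
  have hint : ∀ ν : ℝ → Fin r → ℝ, Continuous ν → (∀ t, ν t ∈ stdSimplex ℝ (Fin r)) →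
      Integrable (fun t => ν t p.1 * M.lam p.1 p.2 (ν t)) (volume.restrict (Ioc 0 T)) := by
    intro ν h1 h2
    exact (((continuous_apply _).comp h1).mul (lam_cont M hp ν h1 h2)).integrableOn_Ioc
  have hcont : ContinuousOn (fun x : Fin r → ℝ => x p.1 * M.lam p.1 p.2 x)
      (stdSimplex ℝ (Fin r)) := (continuous_apply _).continuousOn.mul hK.continuousOn
  have huc := (isCompact_stdSimplex ℝ (Fin r)).uniformContinuousOn_of_continuous hcont
  rw [Metric.tendstoUniformlyOn_iff] at hu
  rw [Metric.uniformContinuousOn_iff] at huc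
  have hu2 : ∀ ε > 0, ∀ᶠ n in (U : Filter ℕ), ∀ t ∈ Icc 0 T,
      dist (μ' t p.1 * M.lam p.1 p.2 (μ' t)) (μ n t p.1 * M.lam p.1 p.2 (μ n t)) < ε := by
    intro ε hε
    obtain ⟨δ, hδ, h⟩ := huc ε hε
    filter_upwards [hu δ hδ] with n hn t ht
    exact h _ (hs' t) _ (hs n t) (hn t ht)
  rw [Metric.tendsto_nhds]
  intro ε hε
  set V := ((volume.restrict (Ioc 0 T)).restrict A).real univ with hV
  have hV0 : 0 ≤ V := measureReal_nonneg
  filter_upwards [hu2 (ε / (V + 1)) (by positivity)] with n hn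
  rw [dist_comm, dist_eq_norm, ← integral_sub (hint _ hμ' hs').restrict (hint _ (hμ n) (hs n)).restrict]
  have hb : ∀ᵐ t ∂((volume.restrict (Ioc 0 T)).restrict A),
      ‖μ' t p.1 * M.lam p.1 p.2 (μ' t) - μ n t p.1 * M.lam p.1 p.2 (μ n t)‖ ≤ ε / (V + 1) := by
    refine ae_restrict_of_ae ?_
    filter_upwards [ae_restrict_mem measurableSet_Ioc] with t ht
    have := hn t (Ioc_subset_Icc_self ht)
    rw [dist_eq_norm] at this
    exact this.le
  refine (norm_integral_le_of_norm_le_const hb).trans_lt ?_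
  rw [div_mul_eq_mul_div, div_lt_iff₀ (by positivity)]
  nlinarith

/-- rate matrix recovered from the fluxes -/
noncomputable def rateOf {r : ℕ} (M : MeanFieldModel r) (μ : ℝ → Fin r → ℝ)
    (q : Fin r × Fin r → ℝ → ℝ) (t : ℝ) (i j : Fin r) : ℝ :=
  if i = j then -∑ k ∈ Finset.univ.filter (fun k => k ≠ i),
    (if (i, k) ∈ M.E then q (i, k) t / μ t i else 0)
  else if (i, j) ∈ M.E then q (i, j) t / μ t i else 0

theorem rateOf_isRate {r : ℕ} (M : MeanFieldModel r) (μ : ℝ → Fin r → ℝ)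
    (q : Fin r × Fin r → ℝ → ℝ) (hμ : Continuous μ) (hs : ∀ t, μ t ∈ stdSimplex ℝ (Fin r))
    (hq : ∀ p ∈ M.E, Measurable (q p)) (hq0 : ∀ p ∈ M.E, ∀ t, 0 ≤ q p t) :
    IsRateMatrix M (rateOf M μ q) := by
  have h1 : ∀ i j, Measurable fun t => (if (i, j) ∈ M.E then q (i, j) t / μ t i else 0) := by
    intro i j
    by_cases h : (i, j) ∈ M.E
    · simp only [h, if_true]
      exact (hq _ h).div ((continuous_apply i).comp hμ).measurable
    · simp only [h, if_false]; exact measurable_const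
  refine ⟨fun i j => ?_, fun t i j hij => ?_, fun t i j hij hE => ?_, fun t i => ?_⟩
  · unfold rateOf
    by_cases h : i = j
    · simp only [h, if_true]
      exact (Finset.measurable_fun_sum _ fun k _ => h1 j k).neg
    · simp only [h, if_false]; exact h1 i j
  · unfold rateOf
    rw [if_neg hij]
    split_ifs with h
    · exact div_nonneg (hq0 _ h t) ((hs t).1 i)
    · exact le_rfl
  · simp [rateOf, hij, hE]
  · conv_lhs => rw [rateOf, if_pos rfl]
    congr 1
    refine Finset.sum_congr rfl fun k hk => ?_
    rw [rateOf, if_neg (Finset.mem_filter.1 hk).2.symm]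

theorem sup_finite {q w : ℝ} (hw : 0 ≤ w)
    (hfin : (⨆ θ : ℚ, ENNReal.ofReal (θ * q - w * (Real.exp θ - 1))) ≠ ⊤) (θ : ℝ) :
    θ * q - w * (Real.exp θ - 1)
      ≤ (⨆ θ : ℚ, ENNReal.ofReal (θ * q - w * (Real.exp θ - 1))).toReal := by
  set B := ⨆ θ : ℚ, ENNReal.ofReal (θ * q - w * (Real.exp θ - 1)) with hB
  have hrat : ∀ θ : ℚ, (θ:ℝ) * q - w * (Real.exp θ - 1) ≤ B.toReal := by
    intro θ
    refine (ENNReal.ofReal_le_iff_le_toReal hfin).1 ?_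
    exact le_iSup (fun θ : ℚ => ENNReal.ofReal (θ * q - w * (Real.exp θ - 1))) θ
  have hcl : IsClosed {θ : ℝ | θ * q - w * (Real.exp θ - 1) ≤ B.toReal} :=
    isClosed_le (by fun_prop) continuous_const
  have := (Rat.isDenseEmbedding_coe_real.dense.closure_eq)
  have h2 : closure (range ((↑) : ℚ → ℝ)) ⊆ {θ : ℝ | θ * q - w * (Real.exp θ - 1) ≤ B.toReal} :=
    hcl.closure_subset_iff.2 (by rintro _ ⟨θ, rfl⟩; exact hrat θ)
  have h3 : closure (range ((↑) : ℚ → ℝ)) = univ := this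
  exact h2 (h3 ▸ mem_univ θ)

theorem sup_finite_zero {q : ℝ} (hq : 0 ≤ q) (B : ℝ)
    (h : ∀ θ : ℝ, θ * q - 0 * (Real.exp θ - 1) ≤ B) : q = 0 := by
  by_contra hne
  have hpos : 0 < q := lt_of_le_of_ne hq (Ne.symm hne)
  have := h ((B + 1) / q)
  rw [div_mul_cancel₀ _ hne] at this
  linarith

open scoped Topology in
theorem exists_limit {r : ℕ} (M : MeanFieldModel r)
    (T : ℝ) (hT : 0 < T) (U : Ultrafilter ℕ)
    (μ : ℕ → ℝ → Fin r → ℝ) (L : ℕ → ℝ → Fin r → Fin r → ℝ)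
    (hL : ∀ n, IsRateMatrix M (L n))
    (hμ : ∀ n, Continuous (μ n)) (hs : ∀ n t, μ n t ∈ stdSimplex ℝ (Fin r))
    (K : ℝ) (hK0 : 0 ≤ K) (hK : ∀ n, runningCost M (μ n) (L n) T ≤ ENNReal.ofReal K)
    (hode : ∀ n, SolvesODE (L n) (μ n) T)
    (c : ℝ≥0∞) (hc : Tendsto (fun n => runningCost M (μ n) (L n) T) U (𝓝 c)) :
    ∃ (μ' : ℝ → Fin r → ℝ) (L' : ℝ → Fin r → Fin r → ℝ), IsRateMatrix M L' ∧ Continuous μ' ∧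
      (∀ t, μ' t ∈ stdSimplex ℝ (Fin r)) ∧ SolvesODE L' μ' T ∧
      (∀ t ∈ Icc 0 T, Tendsto (fun n => μ n t) U (𝓝 (μ' t))) ∧ runningCost M μ' L' T ≤ c := by
  set ρ : Measure ℝ := volume.restrict (Ioc 0 T) with hρ
  have hfin : ∀ n, runningCost M (μ n) (L n) T ≠ ⊤ :=
    fun n => ((hK n).trans_lt ENNReal.ofReal_lt_top).ne
  have hqi : ∀ p ∈ M.E, ∀ n, Integrable (fun t => L n t p.1 p.2 * μ n t p.1) ρ :=
    fun p hp n => flux_integrable M hp T _ _ (hL n) (hμ n) (hs n) (hfin n)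
  have hqn : ∀ p ∈ M.E, ∀ n t, 0 ≤ L n t p.1 p.2 * μ n t p.1 := fun p hp n t =>
    mul_nonneg ((hL n).2.1 t _ _ (off_diag M hp)) ((hs n t).1 _)
  -- limiting fluxes
  have hDP : ∀ p : Fin r × Fin r, ∃ q' : ℝ → ℝ, p ∈ M.E → Measurable q' ∧ (∀ t, 0 ≤ q' t) ∧
      Integrable q' ρ ∧ ∀ A, MeasurableSet A →
        Tendsto (fun n => ∫ t in A, L n t p.1 p.2 * μ n t p.1 ∂ρ) U (𝓝 (∫ t in A, q' t ∂ρ)) := by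
    intro p
    by_cases hp : p ∈ M.E
    swap
    · exact ⟨0, fun h => absurd h hp⟩
    set K' := ENNReal.ofReal K + ENNReal.ofReal (M.Cb * Real.exp 1) * ρ univ with hK'
    have hK'fin : K' ≠ ⊤ := (ENNReal.add_lt_top.2 ⟨ENNReal.ofReal_lt_top,
      ENNReal.mul_lt_top ENNReal.ofReal_lt_top (measure_lt_top _ _)⟩).ne
    obtain ⟨q', hm, h0, hle, hlim⟩ := dunford_pettis ρ U
      (fun n t => ENNReal.ofReal (L n t p.1 p.2 * μ n t p.1))
      (fun n => (((hL n).1 _ _).mul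
        ((continuous_apply _).comp (hμ n)).measurable).ennreal_ofReal) K' hK'fin
      (by
        intro n
        have h := flux_bound M hp (μ n) (L n) (hL n) (hμ n) (hs n) T 1 one_pos univ
        rw [setLIntegral_univ, ENNReal.ofReal_one, one_mul] at h
        exact h.trans (add_le_add (hK n) le_rfl))
      (by
        intro ε hε
        by_cases hεt : ε = ⊤
        · exact ⟨1, one_pos, fun n A _ _ => hεt ▸ le_top⟩
        obtain ⟨δ, hδ, h⟩ := flux_ui M hp T μ L hL hμ hs K hK0 hK ε.toReal
          (ENNReal.toReal_pos hε.ne' hεt)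
        refine ⟨ENNReal.ofReal δ, by simpa using hδ, fun n A _ hA => ?_⟩
        have := h n A hA
        rwa [ENNReal.ofReal_toReal hεt] at this)
    have hi : Integrable q' ρ := by
      refine ⟨hm.aestronglyMeasurable, ?_⟩
      rw [hasFiniteIntegral_iff_ofReal (ae_of_all _ h0)]
      exact hle.trans_lt hK'fin.lt_top
    refine ⟨q', fun _ => ⟨hm, h0, hi, fun A hA => ?_⟩⟩
    rw [integral_eq_lintegral_of_nonneg_ae (ae_of_all _ h0) hi.restrict.aestronglyMeasurable]
    have hne : ∫⁻ t in A, ENNReal.ofReal (q' t) ∂ρ ≠ ⊤ :=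
      ((setLIntegral_le_lintegral _ _).trans_lt (hle.trans_lt hK'fin.lt_top)).ne
    refine ((ENNReal.tendsto_toReal hne).comp (hlim A hA)).congr fun n => ?_
    rw [integral_eq_lintegral_of_nonneg_ae (ae_of_all _ (hqn p hp n))
      (hqi p hp n).restrict.aestronglyMeasurable]
    rfl
  choose q hq using hDP
  -- initial point
  obtain ⟨ν, hν, hνlim⟩ := (isCompact_stdSimplex ℝ (Fin r)).ultrafilter_le_nhds
    (U.map fun n => μ n 0) (by
      rw [le_principal_iff]
      exact Ultrafilter.mem_map.2 (Filter.univ_mem' fun n => hs n 0))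
  have hνlim' : Tendsto (fun n => μ n 0) U (𝓝 ν) := hνlim
  set m : ℝ → Fin r → ℝ := fun t i => ν i + ∑ p ∈ M.E, sg p i * ∫ u in Ioc 0 t, q p u ∂ρ with hmdef
  have hmlim : ∀ t ∈ Icc 0 T, Tendsto (fun n => μ n t) U (𝓝 (m t)) := by
    intro t ht
    rw [tendsto_pi_nhds]
    intro i
    have h1 : Tendsto (fun n => μ n 0 i + ∑ p ∈ M.E, sg p i *
      ∫ u in Ioc 0 t, L n u p.1 p.2 * μ n u p.1 ∂ρ) U (𝓝 (m t i)) :=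
      ((tendsto_pi_nhds.1 hνlim') i).add (tendsto_finsetSum _ fun p hp =>
        ((hq p hp).2.2.2 _ measurableSet_Ioc).const_mul _)
    refine h1.congr fun n => ?_
    exact (traj_flux M T _ _ (hL n) (hμ n) (hs n) (hfin n) (hode n) t ht i).symm
  have hms : ∀ t ∈ Icc 0 T, m t ∈ stdSimplex ℝ (Fin r) := fun t ht =>
    (isClosed_stdSimplex ℝ (Fin r)).mem_of_tendsto (hmlim t ht)
      (Filter.Eventually.of_forall fun n => hs n t)
  have hmc : ContinuousOn m (Icc 0 T) := by
    rw [continuousOn_pi]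
    intro i
    refine continuousOn_const.add (continuousOn_finsetSum _ fun p hp => continuousOn_const.mul ?_)
    have hi : IntegrableOn (q p) (Icc 0 T) :=
      (integrableOn_Icc_iff_integrableOn_Ioc (by simp)).2 (hq p hp).2.2.1
    refine (intervalIntegral.continuousOn_primitive hi).congr fun t ht => ?_
    exact setInt_restrict 0 le_rfl ht.2 _
  set μ' : ℝ → Fin r → ℝ := IccExtend hT.le ((Icc 0 T).domRestrict m) with hμ'def
  have heq : ∀ t ∈ Icc (0:ℝ) T, μ' t = m t := by
    intro t ht
    rw [hμ'def, IccExtend_of_mem _ _ ht]; rfl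
  have hμ' : Continuous μ' := (continuousOn_iff_continuous_domRestrict.1 hmc).Icc_extend'
  have hs' : ∀ t, μ' t ∈ stdSimplex ℝ (Fin r) := fun t => hms _ (projIcc 0 T hT.le t).2
  have hlim' : ∀ t ∈ Icc 0 T, Tendsto (fun n => μ n t) U (𝓝 (μ' t)) := fun t ht => by
    rw [heq t ht]; exact hmlim t ht
  have hunif := traj_unif T U μ μ'
    (fun ε hε => traj_equi M T μ L hL hμ hs K hK0 hK hode ε hε) hlim'
  have hL' : IsRateMatrix M (rateOf M μ' q) := rateOf_isRate M μ' q hμ' hs'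
    (fun p hp => (hq p hp).1) (fun p hp => (hq p hp).2.1)
  -- edge cost limits
  choose ce hce using fun p => ultra_lim_ex U
    (fun n => ∫⁻ t in Ioc 0 T, ENNReal.ofReal (ecost M (μ n) (L n) p t))
  have hcsum : ∑ p ∈ M.E, ce p = c := by
    refine tendsto_nhds_unique (tendsto_finsetSum _ fun p _ => hce p) (hc.congr fun n => ?_)
    exact runningCost_eq M _ _ (hL n) (hμ n) (hs n) T
  have hcK : c ≤ ENNReal.ofReal K := le_of_tendsto' hc hK
  have hcefin : ∀ p ∈ M.E, ce p ≠ ⊤ := fun p hp =>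
    ((Finset.single_le_sum (f := ce) (fun _ _ => bot_le) hp).trans_lt
      ((hcsum.le.trans hcK).trans_lt ENNReal.ofReal_lt_top)).ne
  set F : Fin r × Fin r → ℝ → ℝ≥0∞ := fun p t => ⨆ θ : ℚ, ENNReal.ofReal
    (θ * q p t - μ' t p.1 * M.lam p.1 p.2 (μ' t) * (Real.exp θ - 1)) with hF
  have hwint : ∀ p ∈ M.E, ∀ ν : ℝ → Fin r → ℝ, Continuous ν → (∀ t, ν t ∈ stdSimplex ℝ (Fin r)) →
      Integrable (fun t => ν t p.1 * M.lam p.1 p.2 (ν t)) ρ := by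
    intro p hp ν h1 h2
    exact (((continuous_apply _).comp h1).mul (lam_cont M hp ν h1 h2)).integrableOn_Ioc
  have hwm : ∀ p ∈ M.E, Measurable (fun t => μ' t p.1 * M.lam p.1 p.2 (μ' t)) := fun p hp =>
    (((continuous_apply _).comp hμ').mul (lam_cont M hp μ' hμ' hs')).measurable
  have hFm : ∀ p ∈ M.E, Measurable (F p) := fun p hp =>
    Measurable.iSup fun θ => ((((hq p hp).1).const_mul _).sub
      ((hwm p hp).mul_const _)).ennreal_ofReal
  have hFle : ∀ p ∈ M.E, ∫⁻ t, F p t ∂ρ ≤ ce p := fun p hp =>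
    lsc_edge ρ U (fun n t => L n t p.1 p.2 * μ n t p.1)
      (fun n t => μ n t p.1 * M.lam p.1 p.2 (μ n t)) (q p)
      (fun t => μ' t p.1 * M.lam p.1 p.2 (μ' t)) (hqi p hp)
      (fun n => hwint p hp _ (hμ n) (hs n)) (hq p hp).2.2.1 (hwint p hp _ hμ' hs')
      (hq p hp).1 (hwm p hp) (hq p hp).2.2.2
      (fun A _ => weight_lim M hp T U μ μ' hμ hs hμ' hs' hunif A)
      (fun n t => ENNReal.ofReal (ecost M (μ n) (L n) p t))
      (fun n θ t => ENNReal.ofReal_le_ofReal (ecost_fenchel M hp _ _ (hL n) t (hs n t) θ))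
      (ce p) (hce p)
  have hFfin : ∀ p ∈ M.E, ∀ᵐ t ∂ρ, F p t ≠ ⊤ := fun p hp => by
    filter_upwards [ae_lt_top (hFm p hp) ((hFle p hp).trans_lt (hcefin p hp).lt_top).ne] with t ht
    exact ht.ne
  have hwn : ∀ p ∈ M.E, ∀ t, 0 ≤ μ' t p.1 * M.lam p.1 p.2 (μ' t) := fun p hp t =>
    mul_nonneg ((hs' t).1 _) (M.c_pos.trans_le (M.lam_lower p hp _ (hs' t))).le
  have hLq : ∀ p ∈ M.E, ∀ t, F p t ≠ ⊤ → rateOf M μ' q t p.1 p.2 * μ' t p.1 = q p t := by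
    intro p hp t ht
    have hr : rateOf M μ' q t p.1 p.2 = q p t / μ' t p.1 := by
      rw [rateOf, if_neg (off_diag M hp), if_pos hp]
    rw [hr]
    by_cases h0 : μ' t p.1 = 0
    · rw [h0, mul_zero]
      refine (sup_finite_zero ((hq p hp).2.1 t) (F p t).toReal fun θ => ?_).symm
      have := sup_finite (hwn p hp t) ht θ
      rw [h0, zero_mul] at this
      refine this.trans (le_of_eq ?_)
      simp only [hF, h0, zero_mul]
    · exact div_mul_cancel₀ _ h0
  refine ⟨μ', rateOf M μ' q, hL', hμ', hs', ⟨?_, ?_⟩, hlim', ?_⟩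
  · intro i
    rw [integrableOn_Icc_iff_integrableOn_Ioc]
    simp_rw [flux_sum M _ hL']
    refine integrable_finsetSum _ fun p hp => Integrable.const_mul ?_ _
    refine (hq p hp).2.2.1.congr ?_
    filter_upwards [hFfin p hp] with t ht
    exact (hLq p hp t ht).symm
  · intro t ht i
    have hm0 : m 0 i = ν i := by simp [hmdef]
    rw [heq t ht, heq 0 ⟨le_rfl, hT.le⟩, hm0]
    change ν i + _ = _
    congr 1
    simp_rw [flux_sum M _ hL']
    rw [← setInt_restrict 0 le_rfl ht.2, ← hρ]
    have hae : ∀ p ∈ M.E, q p =ᵐ[ρ] fun t => rateOf M μ' q t p.1 p.2 * μ' t p.1 := by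
      intro p hp
      filter_upwards [hFfin p hp] with t ht
      exact (hLq p hp t ht).symm
    rw [integral_finsetSum _ fun p hp =>
      (((hq p hp).2.2.1.congr (hae p hp)).restrict).const_mul _]
    refine Finset.sum_congr rfl fun p hp => ?_
    rw [integral_const_mul]
    congr 1
    exact integral_congr_ae (ae_restrict_of_ae (hae p hp))
  · rw [runningCost_eq M _ _ hL' hμ' hs' T, ← hcsum]
    refine Finset.sum_le_sum fun p hp => le_trans (lintegral_mono_ae ?_) (hFle p hp)
    filter_upwards [hFfin p hp] with t ht
    rw [← ENNReal.ofReal_toReal ht]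
    refine ENNReal.ofReal_le_ofReal (fenchel_sup _ _ _ _ ((hs' t).1 _)
      (hL'.2.1 t _ _ (off_diag M hp)) (M.c_pos.trans_le (M.lam_lower p hp _ (hs' t))) fun θ => ?_)
    rw [hLq p hp t ht]
    exact sup_finite (hwn p hp t) ht θ

open scoped Topology in
theorem exists_min {r : ℕ} (M : MeanFieldModel r) (T : ℝ) (hT : 0 < T)
    (s : (Fin r → ℝ) → ℝ)
    (hs_nonneg : ∀ ξ ∈ stdSimplex ℝ (Fin r), 0 ≤ s ξ)
    (hs_lsc : LowerSemicontinuousOn s (stdSimplex ℝ (Fin r)))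
    (hDPE : SatisfiesDPE M s) (ξ : Fin r → ℝ) (hξ : ξ ∈ stdSimplex ℝ (Fin r)) :
    ∃ (μ : ℝ → Fin r → ℝ) (L : ℝ → Fin r → Fin r → ℝ), IsRateMatrix M L ∧
      (∀ t, μ t ∈ stdSimplex ℝ (Fin r)) ∧ SolvesODE L μ T ∧ μ T = ξ ∧
      ENNReal.ofReal (s ξ) = ENNReal.ofReal (s (μ 0)) + runningCost M μ L T := by
  have h1 : ∀ n : ℕ, ∃ (μ : ℝ → Fin r → ℝ) (L : ℝ → Fin r → Fin r → ℝ), IsRateMatrix M L ∧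
      Continuous μ ∧ (∀ t, μ t ∈ stdSimplex ℝ (Fin r)) ∧ SolvesODE L μ T ∧ μ T = ξ ∧
      ENNReal.ofReal (s (μ 0)) + runningCost M μ L T <
        ENNReal.ofReal (s ξ) + ENNReal.ofReal (1 / ((n:ℝ) + 1)) := by
    intro n
    have hlt : ENNReal.ofReal (s ξ) < ENNReal.ofReal (s ξ) + ENNReal.ofReal (1 / ((n:ℝ) + 1)) :=
      ENNReal.lt_add_right ENNReal.ofReal_ne_top (by simp; positivity)
    conv_lhs at hlt => rw [hDPE T hT ξ hξ]
    simp only [iInf_lt_iff] at hlt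
    obtain ⟨ν, hν, h⟩ := hlt
    rw [← lt_tsub_iff_left] at h
    simp only [SEnd, SPath, iInf_lt_iff] at h
    obtain ⟨μ, ⟨h0, hTξ⟩, L, ⟨hL, hode, -, hsim⟩, h⟩ := h
    rw [lt_tsub_iff_left] at h
    obtain ⟨μ', hc, hs', e0, eT, ec, hode'⟩ := good_traj M L μ T hT hode hsim
    refine ⟨μ', L, hL, hc, hs', hode', eT.trans hTξ, ?_⟩
    rw [ec, e0, h0]
    exact h
  choose μ L hL hμ hs hode hTξ hlt using h1
  set U : Ultrafilter ℕ := hyperfilter ℕ with hU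
  have hUle : (U : Filter ℕ) ≤ atTop := Nat.hyperfilter_le_atTop
  have hKle : ∀ n, runningCost M (μ n) (L n) T ≤ ENNReal.ofReal (s ξ + 1) := by
    intro n
    refine (le_add_self.trans (hlt n).le).trans ?_
    rw [← ENNReal.ofReal_add (hs_nonneg ξ hξ) (by positivity)]
    refine ENNReal.ofReal_le_ofReal ?_
    have : 1 / ((n:ℝ) + 1) ≤ 1 := by
      rw [div_le_one (by positivity)]
      have : (0:ℝ) ≤ n := by positivity
      linarith
    linarith
  obtain ⟨c, hc⟩ := ultra_lim_ex U (fun n => runningCost M (μ n) (L n) T)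
  obtain ⟨d, hd⟩ := ultra_lim_ex U (fun n => ENNReal.ofReal (s (μ n 0)))
  obtain ⟨μ', L', hL', -, hs', hode', hlim, hle⟩ := exists_limit M T hT U μ L hL hμ hs (s ξ + 1)
    (by have := hs_nonneg ξ hξ; linarith) hKle hode c hc
  have eT : μ' T = ξ := by
    refine tendsto_nhds_unique (hlim T ⟨hT.le, le_rfl⟩) ?_
    simp_rw [hTξ]
    exact tendsto_const_nhds
  have hdc : d + c ≤ ENNReal.ofReal (s ξ) := by
    have h2 : Tendsto (fun n : ℕ => ENNReal.ofReal (s ξ) + ENNReal.ofReal (1 / ((n:ℝ) + 1))) U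
        (𝓝 (ENNReal.ofReal (s ξ) + ENNReal.ofReal 0)) :=
      (tendsto_const_nhds.add (ENNReal.tendsto_ofReal
        tendsto_one_div_add_atTop_nhds_zero_nat)).mono_left hUle
    rw [ENNReal.ofReal_zero, add_zero] at h2
    exact le_of_tendsto_of_tendsto' (hd.add hc) h2 fun n => (hlt n).le
  have hsd : ENNReal.ofReal (s (μ' 0)) ≤ d := by
    refine le_of_forall_lt_imp_le_of_dense fun a ha => ?_
    have ha' : a.toReal < s (μ' 0) := by
      rw [← ENNReal.ofReal_toReal (ha.trans ENNReal.ofReal_lt_top).ne] at ha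
      exact (ENNReal.ofReal_lt_ofReal_iff'.1 ha).1
    have h3 := hs_lsc (μ' 0) (hs' 0) a.toReal ha'
    have h4 : Tendsto (fun n => μ n 0) U (𝓝[stdSimplex ℝ (Fin r)] (μ' 0)) :=
      tendsto_nhdsWithin_iff.2 ⟨hlim 0 ⟨le_rfl, hT.le⟩, Filter.Eventually.of_forall fun n => hs n 0⟩
    refine ge_of_tendsto hd ?_
    filter_upwards [h4.eventually h3] with n hn
    rw [← ENNReal.ofReal_toReal (ha.trans ENNReal.ofReal_lt_top).ne]
    exact ENNReal.ofReal_le_ofReal hn.le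
  refine ⟨μ', L', hL', hs', hode', eT, le_antisymm ?_ ((add_le_add hsd hle).trans hdc)⟩
  rw [hDPE T hT ξ hξ]
  refine (iInf₂_le (μ' 0) (hs' 0)).trans (add_le_add le_rfl ?_)
  refine (iInf₂_le μ' ⟨rfl, eT⟩).trans ?_
  exact iInf₂_le L' ⟨hL', hode', rfl, fun t _ => hs' t⟩

theorem concat {r : ℕ} (M : MeanFieldModel r) (T : ℝ) (hT : 0 < T) (s : (Fin r → ℝ) → ℝ)
    (x : ℕ → Fin r → ℝ) (m : ℕ → ℝ → Fin r → ℝ) (l : ℕ → ℝ → Fin r → Fin r → ℝ)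
    (hl : ∀ k, IsRateMatrix M (l k)) (hs : ∀ k t, m k t ∈ stdSimplex ℝ (Fin r))
    (hode : ∀ k, SolvesODE (l k) (m k) T) (hmT : ∀ k, m k T = x k)
    (hm0 : ∀ k, m k 0 = x (k+1))
    (hcost : ∀ k, ENNReal.ofReal (s (x k)) =
      ENNReal.ofReal (s (x (k+1))) + runningCost M (m k) (l k) T) :
      ∃ (μ : ℝ → Fin r → ℝ) (L : ℝ → Fin r → Fin r → ℝ),
        IsRateMatrix M L ∧ SolvesReversedODE L μ ∧ μ 0 = x 0 ∧
        (∀ t : ℝ, 0 ≤ t → μ t ∈ stdSimplex ℝ (Fin r)) ∧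
        ∀ k : ℕ, 1 ≤ k →
          ENNReal.ofReal (s (x 0)) =
            ENNReal.ofReal (s (μ ((k : ℝ) * T))) + runningCost M μ L ((k : ℝ) * T) := by
  set κ : ℝ → ℕ := fun t => ⌊t / T⌋₊ with hκ
  have hκm : Measurable κ := Nat.measurable_floor.comp (measurable_id.div_const T)
  have hκk : ∀ k : ℕ, ∀ t ∈ Ico ((k:ℝ) * T) (((k:ℝ) + 1) * T), κ t = k := by
    intro k t ht
    rw [hκ]
    refine (Nat.floor_eq_iff ?_).2 ⟨?_, ?_⟩
    · exact div_nonneg (le_trans (by positivity) ht.1) hT.le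
    · rw [le_div_iff₀ hT]; exact ht.1
    · rw [div_lt_iff₀ hT]; exact ht.2
  have hκmem : ∀ t, 0 ≤ t → t ∈ Ico ((κ t:ℝ) * T) (((κ t:ℝ) + 1) * T) := by
    intro t ht
    constructor
    · rw [← le_div_iff₀ hT]; exact Nat.floor_le (by positivity)
    · rw [← div_lt_iff₀ hT]; exact Nat.lt_floor_add_one _
  set μ : ℝ → Fin r → ℝ := fun t => m (κ t) (((κ t : ℝ) + 1) * T - t) with hμ
  set L : ℝ → Fin r → Fin r → ℝ := fun t => l (κ t) (((κ t : ℝ) + 1) * T - t) with hLdef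
  have hgrid : ∀ k : ℕ, μ ((k:ℝ) * T) = x k := by
    intro k
    have : κ ((k:ℝ) * T) = k := hκk k _ ⟨le_rfl, by nlinarith⟩
    simp only [hμ, this]
    rw [← hmT k]
    congr 1
    ring
  have hμk : ∀ k : ℕ, ∀ t ∈ Icc ((k:ℝ) * T) (((k:ℝ) + 1) * T),
      μ t = m k (((k:ℝ) + 1) * T - t) := by
    intro k t ht
    rcases ht.2.eq_or_lt with h | h
    · rw [h, sub_self, hm0 k]
      have := hgrid (k+1)
      push_cast at this
      exact this
    · have := hκk k t ⟨ht.1, h⟩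
      simp only [hμ, this]
  have hLk : ∀ k : ℕ, ∀ t ∈ Ico ((k:ℝ) * T) (((k:ℝ) + 1) * T),
      L t = l k (((k:ℝ) + 1) * T - t) := by
    intro k t ht
    simp only [hLdef, hκk k t ht]
  have hL : IsRateMatrix M L := by
    refine ⟨fun i j => ?_, fun t => (hl _).2.1 _, fun t => (hl _).2.2.1 _, fun t => (hl _).2.2.2 _⟩
    have h1 : Measurable fun z : ℕ × ℝ => l z.1 z.2 i j :=
      measurable_from_prod_countable_right fun k => (hl k).1 i j
    have h2 : Measurable fun t => (κ t, ((κ t : ℝ) + 1) * T - t) := by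
      refine hκm.prodMk (((Measurable.add_const ?_ 1).mul_const T).sub measurable_id)
      exact (measurable_from_nat (f := fun n : ℕ => (n:ℝ))).comp hκm
    exact h1.comp h2
  set h : Fin r → ℝ → ℝ := fun i t => ∑ j, L t j i * μ t j with hh
  set hk : ℕ → Fin r → ℝ → ℝ := fun k i t => ∑ j, l k t j i * m k t j with hhk
  have hae : ∀ a : ℝ, ∀ᵐ t : ℝ, t ≠ a := fun a => by
    simp [ae_iff]
  have hkint : ∀ k i, IntervalIntegrable (hk k i) volume 0 T := by
    intro k i
    rw [intervalIntegrable_iff_integrableOn_Icc_of_le hT.le]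
    exact (hode k).1 i
  have piece : ∀ k : ℕ, ∀ i, ∀ t ∈ Icc ((k:ℝ) * T) (((k:ℝ) + 1) * T),
      IntervalIntegrable (h i) volume (k * T) t ∧ ∫ u in ((k:ℝ) * T)..t, h i u = x k i - μ t i := by
    intro k i t ht
    have haeq : ∀ᵐ u : ℝ, u ∈ Set.uIoc ((k:ℝ) * T) t → h i u = hk k i (((k:ℝ) + 1) * T - u) := by
      filter_upwards [hae (((k:ℝ) + 1) * T)] with u hu hu2
      rw [uIoc_of_le ht.1] at hu2
      have hu3 : u ∈ Ico ((k:ℝ) * T) (((k:ℝ) + 1) * T) :=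
        ⟨hu2.1.le, lt_of_le_of_ne (hu2.2.trans ht.2) hu⟩
      simp only [hh, hhk, hLk k u hu3, hμk k u (Ico_subset_Icc_self hu3)]
    set v := ((k:ℝ) + 1) * T - t with hv
    have hv0 : 0 ≤ v := by have := ht.2; linarith
    have hvT : v ≤ T := by have := ht.1; linarith
    have i0v : IntervalIntegrable (hk k i) volume 0 v :=
      (hkint k i).mono_set (by rw [uIcc_of_le hv0, uIcc_of_le hT.le]; exact Icc_subset_Icc_right hvT)
    have ivT : IntervalIntegrable (hk k i) volume v T :=
      (hkint k i).mono_set (by rw [uIcc_of_le hvT, uIcc_of_le hT.le]; exact Icc_subset_Icc_left hv0)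
    constructor
    · have h3 := (ivT.comp_sub_left (((k:ℝ) + 1) * T)).symm
      have e1 : ((k:ℝ) + 1) * T - T = k * T := by ring
      have e2 : ((k:ℝ) + 1) * T - v = t := by rw [hv]; ring
      rw [e1, e2] at h3
      refine h3.congr_ae ?_
      rw [Filter.EventuallyEq, ae_restrict_iff' measurableSet_uIoc]
      filter_upwards [haeq] with u hu hu2 using (hu hu2).symm
    · rw [intervalIntegral.integral_congr_ae haeq,
        intervalIntegral.integral_comp_sub_left (fun u => hk k i u) (((k:ℝ) + 1) * T)]
      have e1 : ((k:ℝ) + 1) * T - k * T = T := by ring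
      rw [e1, ← hv]
      have hT1 := (hode k).2 T ⟨hT.le, le_rfl⟩ i
      have hv1 := (hode k).2 v ⟨hv0, hvT⟩ i
      rw [← intervalIntegral.integral_of_le hT.le] at hT1
      rw [← intervalIntegral.integral_of_le hv0] at hv1
      have hadd := intervalIntegral.integral_add_adjacent_intervals i0v ivT
      rw [hμk k t ht, ← hv, ← hmT k]
      change _ = _ + ∫ u in (0:ℝ)..T, hk k i u at hT1
      change _ = _ + ∫ u in (0:ℝ)..v, hk k i u at hv1
      linarith
  have full : ∀ k : ℕ, ∀ i, IntervalIntegrable (h i) volume 0 (k * T) ∧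
      ∫ u in (0:ℝ)..((k:ℝ) * T), h i u = x 0 i - x k i := by
    intro k i
    induction k with
    | zero => simp
    | succ k ih =>
      have hp := piece k i (((k:ℝ) + 1) * T) ⟨by nlinarith, le_rfl⟩
      have hg := hgrid (k+1)
      push_cast at hg ⊢
      refine ⟨ih.1.trans hp.1, ?_⟩
      rw [← intervalIntegral.integral_add_adjacent_intervals ih.1 hp.1, ih.2, hp.2, hg]
      ring
  have final : ∀ t, 0 ≤ t → ∀ i, IntervalIntegrable (h i) volume 0 t ∧
      ∫ u in (0:ℝ)..t, h i u = x 0 i - μ t i := by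
    intro t ht i
    have hp := piece (κ t) i t (Ico_subset_Icc_self (hκmem t ht))
    have hf := full (κ t) i
    refine ⟨hf.1.trans hp.1, ?_⟩
    rw [← intervalIntegral.integral_add_adjacent_intervals hf.1 hp.1, hf.2, hp.2]
    ring
  have hμ0 : μ 0 = x 0 := by simpa using hgrid 0
  refine ⟨μ, L, hL, ⟨?_, ?_⟩, hμ0, fun t _ => hs _ _, ?_⟩
  · intro t ht i
    have := (final t ht.le i).1
    rwa [intervalIntegrable_iff_integrableOn_Icc_of_le ht.le] at this
  · intro t ht i
    have := (final t ht i).2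
    rw [intervalIntegral.integral_of_le ht] at this
    change _ = _ - ∫ s in Ioc (0 : ℝ) t, h i s
    rw [this, hμ0]
    ring
  · intro k _
    rw [hgrid]
    clear * - hκk hae hcost hμk hLk hT
    induction k with
    | zero => simp [runningCost]
    | succ k ih =>
      rw [ih, hcost k, add_assoc]
      congr 1
      push_cast
      have hsplit : Ioc (0:ℝ) (((k:ℝ)+1) * T) = Ioc 0 ((k:ℝ) * T) ∪ Ioc ((k:ℝ) * T) (((k:ℝ)+1) * T) :=
        (Ioc_union_Ioc_eq_Ioc (by positivity) (by nlinarith)).symm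
      unfold runningCost
      rw [hsplit, lintegral_union measurableSet_Ioc (Ioc_disjoint_Ioc_of_le le_rfl), add_comm]
      congr 1
      set G : ℝ → ℝ≥0∞ := fun t => ENNReal.ofReal (∑ p ∈ M.E, m k t p.1 * M.lam p.1 p.2 (m k t) *
        tauStar (l k t p.1 p.2 / M.lam p.1 p.2 (m k t) - 1)) with hG
      rw [setLIntegral_congr (Ioo_ae_eq_Ioc (a := (0:ℝ)) (b := T)).symm,
        setLIntegral_congr (Ioo_ae_eq_Ioc (a := (k:ℝ) * T) (b := ((k:ℝ)+1) * T)).symm,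
        ← lintegral_indicator measurableSet_Ioo, ← lintegral_indicator measurableSet_Ioo,
        ← lintegral_sub_left_eq_self _ (((k:ℝ)+1) * T)]
      refine lintegral_congr fun t => ?_
      by_cases ht : t ∈ Ioo ((k:ℝ) * T) (((k:ℝ)+1) * T)
      · have ht2 : ((k:ℝ)+1) * T - t ∈ Ioo 0 T := ⟨by linarith [ht.2], by linarith [ht.1]⟩
        rw [indicator_of_mem ht, indicator_of_mem ht2, hLk k t ⟨ht.1.le, ht.2⟩,
          hμk k t ⟨ht.1.le, ht.2.le⟩]
      · have ht2 : ((k:ℝ)+1) * T - t ∉ Ioo 0 T := fun h => ht ⟨by linarith [h.2], by linarith [h.1]⟩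
        rw [indicator_of_notMem ht, indicator_of_notMem ht2]

/-- existence of an optimal infinite-horizon reversed-time path.
If `s ≥ 0` is lower semicontinuous on `M₁(Z)`, satisfies the dynamic programming
equation, and vanishes somewhere, then from every `ξ ∈ M₁(Z)` there is a path
`μ̂` staying in `M₁(Z)`, driven by a time-varying rate matrix `L̂` via
`μ̂̇ = −L̂ᵀ μ̂`, with `μ̂(0) = ξ` and
`s(ξ) = s(μ̂(mT)) + I_{[0,mT]}(μ̂, L̂)` for every `m ≥ 1`. -/
theorem stmt9 (r : ℕ) (hr : 0 < r) (M : MeanFieldModel r) (T : ℝ) (hT : 0 < T)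
    (s : (Fin r → ℝ) → ℝ)
    (hs_nonneg : ∀ ξ ∈ stdSimplex ℝ (Fin r), 0 ≤ s ξ)
    (hs_lsc : LowerSemicontinuousOn s (stdSimplex ℝ (Fin r)))
    (hDPE : SatisfiesDPE M s)
    (hzero : ∃ ν ∈ stdSimplex ℝ (Fin r), s ν = 0) :
    ∀ ξ ∈ stdSimplex ℝ (Fin r),
      ∃ (μ : ℝ → Fin r → ℝ) (L : ℝ → Fin r → Fin r → ℝ),
        IsRateMatrix M L ∧ SolvesReversedODE L μ ∧ μ 0 = ξ ∧
        (∀ t : ℝ, 0 ≤ t → μ t ∈ stdSimplex ℝ (Fin r)) ∧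
        ∀ m : ℕ, 1 ≤ m →
          ENNReal.ofReal (s ξ) =
            ENNReal.ofReal (s (μ ((m : ℝ) * T))) + runningCost M μ L ((m : ℝ) * T) := by
  intro ξ hξ
  have step : ∀ y : stdSimplex ℝ (Fin r), ∃ (y' : stdSimplex ℝ (Fin r)) (μ : ℝ → Fin r → ℝ)
      (L : ℝ → Fin r → Fin r → ℝ), IsRateMatrix M L ∧
      (∀ t, μ t ∈ stdSimplex ℝ (Fin r)) ∧ SolvesODE L μ T ∧ μ T = y.1 ∧ μ 0 = y'.1 ∧
      ENNReal.ofReal (s y.1) = ENNReal.ofReal (s y'.1) + runningCost M μ L T := by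
    intro y
    obtain ⟨μ, L, h1, h2, h3, h4, h5⟩ := exists_min M T hT s hs_nonneg hs_lsc hDPE y.1 y.2
    exact ⟨⟨μ 0, h2 0⟩, μ, L, h1, h2, h3, h4, rfl, h5⟩
  choose nx μ L h1 h2 h3 h4 h5 h6 using step
  have hit : ∀ k, nx^[k+1] ⟨ξ, hξ⟩ = nx (nx^[k] ⟨ξ, hξ⟩) := fun k =>
    Function.iterate_succ_apply' nx k _
  exact concat M T hT s (fun k => (nx^[k] ⟨ξ, hξ⟩).1) (fun k => μ (nx^[k] ⟨ξ, hξ⟩))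
    (fun k => L (nx^[k] ⟨ξ, hξ⟩)) (fun k => h1 _) (fun k => h2 _) (fun k => h3 _)
    (fun k => h4 _) (fun k => by simp only [hit]; exact h5 _) (fun k => by simp only [hit]; exact h6 _)
end

section
/- Under assumptions (A1)–(A3), fix T > 0, let s : M_1(Z) → [0,∞) be lower semicontinuous, satisfy the dynamic programming equation, and attain the value 0 at some point, and let μ̂ : [0,∞) → M_1(Z) be an absolutely continuous path with μ̂̇(t) = −L̂(t)^⊤ μ̂(t) a.e. for some time-varying rate matrix L̂, μ̂(t) ∈ M_1(Z) for all t ≥ 0, and s(μ̂(0)) = s(μ̂(mT)) + ∫_0^{mT} Σ_{(i,j)∈E} μ̂(t)(i) λ_{i,j}(μ̂(t)) τ*( l̂_{i,j}(t)/λ_{i,j}(μ̂(t)) − 1 ) dt for every integer m ≥ 1. Then the ω-limit set Ω = ∩_{t>0} closure{ μ̂(t') : t' ≥ t } is positively invariant for the time-reversed McKean–Vlasov equation: every solution η of η̇(t) = −A_{η(t)}^⊤ η(t) with η(0) ∈ Ω satisfies η(t) ∈ Ω for all t ≥ 0. -/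
open MeasureTheory Set ENNReal Filter

lemma tau_legendre (v θ : ℝ) (hv : 0 ≤ v) :
    (v - 1) * θ - (Real.exp θ - 1 - θ) ≤ tauStar (v - 1) := by
  unfold tauStar
  rcases hv.eq_or_lt with h | h
  · subst h
    simp
    have := Real.exp_pos θ
    linarith
  · have h1 := Real.add_one_le_exp (θ - Real.log v)
    rw [Real.exp_sub, Real.exp_log h, le_div_iff₀ h] at h1
    simp only [sub_add_cancel]
    nlinarith

lemma tau_abs (v a : ℝ) (hv : 0 ≤ v) (ha : 0 < a) (ha1 : a ≤ 1) :
    |v - 1| ≤ a + tauStar (v - 1) / a := by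
  have h1 := tau_legendre v a hv
  have h2 := tau_legendre v (-a) hv
  have h3 := (abs_le.1 (Real.abs_exp_sub_one_sub_id_le (x := a) (by rw [abs_of_pos ha]; exact ha1))).2
  have h4 := (abs_le.1 (Real.abs_exp_sub_one_sub_id_le (x := -a)
    (by rw [abs_neg, abs_of_pos ha]; exact ha1))).2
  rw [← sub_le_iff_le_add', le_div_iff₀ ha]
  rcases abs_cases (v - 1) with ⟨h, _⟩ | ⟨h, _⟩ <;> rw [h] <;> nlinarith

lemma tau_nonneg (v : ℝ) (hv : 0 ≤ v) : 0 ≤ tauStar (v - 1) := by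
  have h1 := tau_legendre v 0 hv
  simpa using h1

section
variable (M : MeanFieldModel r)

lemma lam_nonneg' {i j : Fin r} (hij : i ≠ j) {x : Fin r → ℝ} (hx : x ∈ stdSimplex ℝ (Fin r)) :
    0 ≤ M.lam i j x := by
  by_cases h : (i, j) ∈ M.E
  · exact M.c_pos.le.trans (M.lam_lower _ h x hx)
  · exact (M.lam_off i j hij h x).ge

lemma lam_le' {i j : Fin r} (hij : i ≠ j) {x : Fin r → ℝ} (hx : x ∈ stdSimplex ℝ (Fin r)) :
    M.lam i j x ≤ |M.Cb| := by
  by_cases h : (i, j) ∈ M.E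
  · exact (M.lam_upper _ h x hx).trans (le_abs_self _)
  · exact (M.lam_off i j hij h x).trans_le (abs_nonneg _)

/-- bounded and Lipschitz -/
def BL (S : Set (Fin r → ℝ)) (f : (Fin r → ℝ) → ℝ) : Prop :=
  ∃ B K : ℝ, 0 ≤ B ∧ 0 ≤ K ∧ ∀ x ∈ S, |f x| ≤ B ∧ ∀ y ∈ S, |f x - f y| ≤ K * dist x y

lemma BL.zero (S : Set (Fin r → ℝ)) : BL S (fun _ => 0) := ⟨0, 0, le_rfl, le_rfl, by simp⟩

lemma BL.add {S : Set (Fin r → ℝ)} {f g} (hf : BL S f) (hg : BL S g) :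
    BL S (fun x => f x + g x) := by
  obtain ⟨B, K, hB, hK, h⟩ := hf
  obtain ⟨B', K', hB', hK', h'⟩ := hg
  refine ⟨B + B', K + K', by positivity, by positivity, fun x hx => ⟨?_, fun y hy => ?_⟩⟩
  · exact (abs_add_le _ _).trans (add_le_add (h x hx).1 (h' x hx).1)
  · have e : f x + g x - (f y + g y) = (f x - f y) + (g x - g y) := by ring
    rw [e, add_mul]
    exact (abs_add_le _ _).trans (add_le_add ((h x hx).2 y hy) ((h' x hx).2 y hy))

lemma BL.mul {S : Set (Fin r → ℝ)} {f g} (hf : BL S f) (hg : BL S g) :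
    BL S (fun x => f x * g x) := by
  obtain ⟨B, K, hB, hK, h⟩ := hf
  obtain ⟨B', K', hB', hK', h'⟩ := hg
  refine ⟨B * B', B * K' + K * B', by positivity, by positivity, fun x hx => ⟨?_, fun y hy => ?_⟩⟩
  · rw [abs_mul]
    exact mul_le_mul (h x hx).1 (h' x hx).1 (abs_nonneg _) hB
  · have e : f x * g x - f y * g y = f x * (g x - g y) + (f x - f y) * g y := by ring
    rw [e, add_mul]
    refine (abs_add_le _ _).trans (add_le_add ?_ ?_)
    · rw [abs_mul, mul_assoc]
      exact mul_le_mul (h x hx).1 ((h' x hx).2 y hy) (abs_nonneg _) hB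
    · rw [abs_mul, mul_right_comm]
      exact mul_le_mul ((h x hx).2 y hy) (h' y hy).1 (abs_nonneg _) (by positivity)

lemma BL.neg {S : Set (Fin r → ℝ)} {f} (hf : BL S f) : BL S (fun x => - f x) := by
  obtain ⟨B, K, hB, hK, h⟩ := hf
  refine ⟨B, K, hB, hK, fun x hx => ⟨by rw [abs_neg]; exact (h x hx).1, fun y hy => ?_⟩⟩
  have e : - f x - - f y = - (f x - f y) := by ring
  rw [e, abs_neg]
  exact (h x hx).2 y hy

lemma BL.sum {S : Set (Fin r → ℝ)} {ι : Type} (s : Finset ι) (f : ι → (Fin r → ℝ) → ℝ)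
    (h : ∀ i ∈ s, BL S (f i)) : BL S (fun x => ∑ i ∈ s, f i x) := by
  classical
  induction s using Finset.induction_on with
  | empty => simpa using BL.zero S
  | insert a s ha ih =>
    simp only [Finset.sum_insert ha]
    exact (h a (by simp)).add (ih (fun i hi => h i (by simp [hi])))

lemma BL.lam_off (i j : Fin r) (hij : i ≠ j) : BL (stdSimplex ℝ (Fin r)) (M.lam i j) := by
  by_cases h : (i, j) ∈ M.E
  · obtain ⟨K, hK⟩ := M.lam_lipschitz _ h
    refine ⟨|M.Cb|, K, abs_nonneg _, K.2, fun x hx => ⟨?_, fun y hy => ?_⟩⟩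
    · rw [abs_of_nonneg (lam_nonneg' M hij hx)]
      exact lam_le' M hij hx
    · exact hK.dist_le_mul x hx y hy
  · have : M.lam i j = fun _ => 0 := funext (M.lam_off i j hij h)
    rw [this]; exact BL.zero _

lemma BL.lam (i j : Fin r) : BL (stdSimplex ℝ (Fin r)) (M.lam i j) := by
  by_cases hij : i = j
  · subst hij
    have : M.lam i i = _ := funext (M.lam_diag i)
    rw [this]
    exact (BL.sum _ _ (fun j hj => BL.lam_off M i j (by simpa using (Finset.mem_filter.1 hj).2.symm))).neg
  · exact BL.lam_off M i j hij

lemma BL.coord (j : Fin r) : BL (stdSimplex ℝ (Fin r)) (fun x => x j) := by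
  refine ⟨1, 1, zero_le_one, zero_le_one, fun x hx => ⟨?_, fun y hy => ?_⟩⟩
  · have := mem_Icc_of_mem_stdSimplex hx j
    rw [abs_of_nonneg this.1]; exact this.2
  · rw [one_mul]; exact dist_le_pi_dist x y j

lemma exists_ext : ∃ (K : NNReal) (G : (Fin r → ℝ) → (Fin r → ℝ)), 1 ≤ K ∧ LipschitzWith K G ∧
    ∀ x ∈ stdSimplex ℝ (Fin r), ∀ i, G x i = ∑ j, M.lam j i x * x j := by
  have h : ∀ i, BL (stdSimplex ℝ (Fin r)) (fun x => ∑ j, M.lam j i x * x j) := fun i =>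
    BL.sum _ _ (fun j _ => (BL.lam M j i).mul (BL.coord j))
  choose B K hB hK h using h
  have hs : 0 ≤ ∑ i, K i := Finset.sum_nonneg (fun i _ => hK i)
  have hl : LipschitzOnWith (1 + Real.toNNReal (∑ i, K i))
      (fun (x : Fin r → ℝ) (i : Fin r) => ∑ j, M.lam j i x * x j) (stdSimplex ℝ (Fin r)) := by
    refine LipschitzOnWith.of_dist_le_mul (fun x hx y hy => ?_)
    refine (dist_pi_le_iff (by positivity)).2 (fun i => ?_)
    rw [Real.dist_eq]
    refine ((h i x hx).2 y hy).trans ?_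
    refine mul_le_mul_of_nonneg_right ?_ dist_nonneg
    have : K i ≤ ∑ i, K i := Finset.single_le_sum (fun i _ => hK i) (Finset.mem_univ i)
    rw [NNReal.coe_add, NNReal.coe_one, Real.coe_toNNReal _ hs]
    linarith
  obtain ⟨G, hG, he⟩ := hl.extend_pi
  exact ⟨_, G, le_self_add, hG, fun x hx i => (congrFun (he hx) i).symm⟩

end

lemma gronwall_le {δ K ε x : ℝ} (_hδ : 0 ≤ δ) (hK : 1 ≤ K) (hε : 0 ≤ ε) (hx : 0 ≤ x) :
    gronwallBound δ K ε x ≤ (δ + ε) * Real.exp (K * x) := by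
  rw [gronwallBound_of_K_ne_0 (by linarith)]
  have h1 : ε / K ≤ ε := div_le_self hε hK
  have h2 : 1 ≤ Real.exp (K * x) := Real.one_le_exp (by positivity)
  have : ε / K * (Real.exp (K * x) - 1) ≤ ε * Real.exp (K * x) :=
    mul_le_mul h1 (by linarith) (by linarith) hε
  linarith

lemma limit_exists {K : NNReal} {G : (Fin r → ℝ) → (Fin r → ℝ)} (hK : 1 ≤ K)
    (hG : LipschitzWith K G) (w : ℕ → ℝ → Fin r → ℝ) (hw : ∀ n, Continuous (w n))
    (hb : ∀ n t, ‖w n t‖ ≤ 1) (x : Fin r → ℝ) (hx : Tendsto (fun n => w n 0) atTop (nhds x))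
    (he : ∀ R : ℝ, 0 < R → ∀ ε : ℝ, 0 < ε → ∀ᶠ n in atTop, ∀ t ∈ Icc 0 R,
      ‖w n t - w n 0 + ∫ s in (0:ℝ)..t, G (w n s)‖ ≤ ε) :
    ∃ ζ : ℝ → Fin r → ℝ, ζ 0 = x ∧ (∀ t, 0 ≤ t → Tendsto (fun n => w n t) atTop (nhds (ζ t))) ∧
      ∀ t, 0 ≤ t → HasDerivAt ζ (- G (ζ t)) t := by
  have hGc := hG.continuous
  set u : ℕ → ℝ → Fin r → ℝ := fun n t => w n 0 - ∫ s in (0:ℝ)..t, G (w n s) with hu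
  have hud : ∀ n t, HasDerivAt (u n) (- G (w n t)) t := fun n t =>
    ((hGc.comp (hw n)).integral_hasStrictDerivAt 0 t).hasDerivAt.const_sub _
  have hdist : ∀ n t, dist (w n t) (u n t) = ‖w n t - w n 0 + ∫ s in (0:ℝ)..t, G (w n s)‖ := by
    intro n t
    rw [dist_eq_norm, hu]
    congr 1
    simp only
    abel
  have hlim : ∀ t, 0 ≤ t → ∃ z, Tendsto (fun n => w n t) atTop (nhds z) := by
    intro t ht
    apply cauchySeq_tendsto_of_complete
    rw [Metric.cauchySeq_iff']
    intro ε hε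
    set D := Real.exp (K * t) with hD
    have hDp : 1 ≤ D := Real.one_le_exp (by positivity)
    have hK1 : (1:ℝ) ≤ K := by exact_mod_cast hK
    set ε' := ε / (8 * K * D) with hε'
    have hε'p : 0 < ε' := by positivity
    have hε'e : ε' * (8 * K * D) = ε := by rw [hε']; field_simp
    obtain ⟨N, hN⟩ := ((he (t + 1) (by linarith) ε' hε'p).and
      (hx.eventually (Metric.ball_mem_nhds x hε'p))).exists_forall_of_atTop
    refine ⟨N, fun n hn => ?_⟩
    have key : ∀ m, N ≤ m → ∀ s ∈ Icc 0 (t+1), dist (w m s) (u m s) ≤ ε' := fun m hm s hs => by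
      rw [hdist]; exact (hN m hm).1 s hs
    have hder : ∀ m, N ≤ m → ∀ s ∈ Ico 0 t, dist (- G (w m s)) (- G (u m s)) ≤ K * ε' :=
      fun m hm s hs => by
        rw [dist_neg_neg]
        refine (hG.dist_le_mul _ _).trans (mul_le_mul_of_nonneg_left (key m hm s ⟨hs.1, ?_⟩) K.2)
        linarith [hs.2]
    have hu0 : ∀ m, u m 0 = w m 0 := by intro m; simp [hu]
    have hG' : LipschitzWith K (fun x => - G x) := by
      exact hG.neg
    have hgr := dist_le_of_approx_trajectories_ODE (v := fun _ x => - G x) (K := K)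
      (f := u n) (g := u N) (f' := fun s => - G (w n s)) (g' := fun s => - G (w N s))
      (a := 0) (b := t) (εf := K * ε') (εg := K * ε') (δ := 2 * ε') (fun _ => hG')
      (fun s _ => (hud n s).continuousAt.continuousWithinAt)
      (fun s _ => (hud n s).hasDerivWithinAt) (hder n hn)
      (fun s _ => (hud N s).continuousAt.continuousWithinAt)
      (fun s _ => (hud N s).hasDerivWithinAt) (hder N le_rfl)
      (by
        rw [hu0, hu0]
        have h1 := (hN n hn).2
        have h2 := (hN N le_rfl).2
        linarith [dist_triangle_right (w n 0) (w N 0) x]) t ⟨ht, le_rfl⟩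
    have hgr2 := hgr.trans (gronwall_le (by positivity) hK1 (by positivity) (by linarith))
    rw [sub_zero, ← hD] at hgr2
    have h1 := key n hn t ⟨ht, by linarith⟩
    have h2 := key N le_rfl t ⟨ht, by linarith⟩
    have h3 := dist_triangle4 (w n t) (u n t) (u N t) (w N t)
    rw [dist_comm (u N t)] at h3
    have h4 : ε' ≤ ε' * (K * D) := le_mul_of_one_le_right hε'p.le (one_le_mul_of_one_le_of_one_le hK1 hDp)
    have h5 : ε' * D ≤ ε' * (K * D) := by
      refine mul_le_mul_of_nonneg_left ?_ hε'p.le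
      exact le_mul_of_one_le_left (by linarith) hK1
    have h6 : (2 * ε' + (K * ε' + K * ε')) * D = 2 * (ε' * D) + 2 * (ε' * (K * D)) := by ring
    have h7 : 0 < ε' * (K * D) := by positivity
    nlinarith
  have hlim' : ∀ t : ℝ, ∃ z, Tendsto (fun n => w n (max t 0)) atTop (nhds z) :=
    fun t => hlim _ (le_max_right _ _)
  choose z hz using hlim'
  have hzm : StronglyMeasurable z := stronglyMeasurable_of_tendsto atTop
    (f := fun n t => w n (max t 0))
    (fun n => ((hw n).comp (by fun_prop)).stronglyMeasurable) (tendsto_pi_nhds.2 hz)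
  have hzb : ∀ t, ‖z t‖ ≤ 1 := fun t =>
    le_of_tendsto (hz t).norm (Eventually.of_forall (fun n => hb n _))
  have hGb : ∀ y : Fin r → ℝ, ‖y‖ ≤ 1 → ‖G y‖ ≤ ‖G 0‖ + K := by
    intro y hy
    have h1 := hG.dist_le_mul y 0
    rw [dist_eq_norm, dist_zero_right] at h1
    have h2 := norm_sub_norm_le (G y) (G 0)
    have h3 : (K:ℝ) * ‖y‖ ≤ K * 1 := mul_le_mul_of_nonneg_left hy K.2
    linarith
  have hint : ∀ a b, IntervalIntegrable (fun s => G (z s)) volume a b := by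
    intro a b
    refine (intervalIntegrable_const (c := ‖G 0‖ + K)).mono_fun
      (hGc.comp_stronglyMeasurable hzm).aestronglyMeasurable (Eventually.of_forall fun s => ?_)
    simp only
    rw [Real.norm_eq_abs]
    exact (hGb _ (hzb s)).trans (le_abs_self _)
  set ζ : ℝ → Fin r → ℝ := fun t => x - ∫ s in (0:ℝ)..t, G (z s) with hζ
  have hζz : ∀ t, 0 ≤ t → ζ t = z t := by
    intro t ht
    have h1 : Tendsto (fun n => ∫ s in (0:ℝ)..t, G (w n s)) atTop
        (nhds (∫ s in (0:ℝ)..t, G (z s))) := by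
      refine intervalIntegral.tendsto_integral_filter_of_dominated_convergence (fun _ => ‖G 0‖ + K)
        (Eventually.of_forall fun n => (hGc.comp (hw n)).aestronglyMeasurable)
        (Eventually.of_forall fun n => Eventually.of_forall fun s _ => hGb _ (hb n s))
        intervalIntegrable_const (Eventually.of_forall fun s hs => ?_)
      rw [uIoc_of_le ht] at hs
      have := hz s
      rw [max_eq_left hs.1.le] at this
      exact (hGc.tendsto _).comp this
    have h2 : Tendsto (fun n => u n t) atTop (nhds (ζ t)) := hx.sub h1
    have h3 : Tendsto (fun n => w n t) atTop (nhds (z t)) := by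
      have := hz t
      rwa [max_eq_left ht] at this
    have h4 : Tendsto (fun n => dist (w n t) (u n t)) atTop (nhds 0) := by
      rw [Metric.tendsto_nhds]
      intro ε hε
      filter_upwards [he (t+1) (by linarith) (ε/2) (by linarith)] with n hn
      rw [Real.dist_eq, sub_zero, abs_of_nonneg dist_nonneg, hdist]
      linarith [hn t ⟨ht, by linarith⟩]
    have h5 := tendsto_nhds_unique h4 (h3.dist h2)
    exact (dist_eq_zero.1 h5.symm).symm
  have hzz : ∀ t, z t = z (max t 0) := by
    intro t
    have h1 := hz t
    have h2 := hz (max t 0)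
    rw [max_eq_left (le_max_right t 0)] at h2
    exact tendsto_nhds_unique h1 h2
  have hζc : Continuous ζ :=
    continuous_const.sub (intervalIntegral.continuous_primitive hint 0)
  have hzc : Continuous z := by
    have : z = fun t => ζ (max t 0) := by
      funext t
      rw [hζz _ (le_max_right _ _), ← hzz]
    rw [this]
    exact hζc.comp (by fun_prop)
  refine ⟨ζ, by simp [hζ], fun t ht => ?_, fun t ht => ?_⟩
  · have := hz t
    rw [max_eq_left ht] at this
    rwa [hζz t ht]
  · rw [hζz t ht]
    exact ((hGc.comp hzc).integral_hasStrictDerivAt 0 t).hasDerivAt.const_sub _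

lemma tail_small (c : ℝ → ℝ≥0∞) (T : ℝ) (hT : 0 < T) (B : ℝ≥0∞) (hBt : B ≠ ⊤)
    (hB : ∀ m : ℕ, 1 ≤ m → ∫⁻ t in Ioc (0:ℝ) (m * T), c t ≤ B) (R : ℝ) (hR : 0 < R)
    (δ : ℝ≥0∞) (hδ : δ ≠ 0) :
    ∃ N : ℝ, 0 ≤ N ∧ ∀ τ, N ≤ τ → ∫⁻ t in Ioc τ (τ + R), c t ≤ δ := by
  set Φ : ℝ → ℝ≥0∞ := fun t => ∫⁻ s in Ioc (0:ℝ) t, c s with hΦ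
  have hmono : Monotone Φ := fun a b hab => lintegral_mono_set (Ioc_subset_Ioc_right hab)
  have hb : ∀ t, Φ t ≤ B := by
    intro t
    obtain ⟨m, hm⟩ := exists_nat_gt (t / T)
    rw [div_lt_iff₀ hT] at hm
    refine (hmono (show t ≤ ((m + 1 : ℕ) : ℝ) * T by push_cast; nlinarith)).trans
      (hB (m + 1) (by omega))
  set B' := ⨆ t, Φ t with hB'
  have hB't : B' ≠ ⊤ := ne_top_of_le_ne_top hBt (iSup_le hb)
  have hsup : ∀ t, Φ t ≤ B' := fun t => le_iSup Φ t
  have hadd : ∀ N τ, 0 ≤ N → N ≤ τ → Φ N + ∫⁻ t in Ioc τ (τ + R), c t ≤ B' := by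
    intro N τ hN hτ
    rw [hΦ]
    simp only
    rw [← lintegral_union measurableSet_Ioc]
    · refine le_trans (lintegral_mono_set ?_) (hsup (τ + R))
      intro s hs
      rcases hs with hs | hs
      · exact ⟨hs.1, by linarith [hs.2]⟩
      · exact ⟨by linarith [hs.1], hs.2⟩
    · rw [Set.disjoint_left]
      intro s hs hs'
      linarith [hs.2, hs'.1]
  rcases le_or_gt B' δ with h | h
  · exact ⟨0, le_rfl, fun τ hτ => (le_add_self.trans (hadd 0 τ le_rfl hτ)).trans h⟩
  · have h1 : B' - δ < B' := ENNReal.sub_lt_self hB't (pos_of_gt h).ne' hδ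
    rw [hB', lt_iSup_iff] at h1
    obtain ⟨N, hN⟩ := h1
    rw [← hB'] at hN
    refine ⟨max N 0, le_max_right _ _, fun τ hτ => ?_⟩
    have h2 := hadd (max N 0) τ (le_max_right _ _) hτ
    have h3 : B' - δ ≤ Φ (max N 0) := hN.le.trans (hmono (le_max_left _ _))
    have h4 : (B' - δ) + ∫⁻ t in Ioc τ (τ + R), c t ≤ (B' - δ) + δ := by
      rw [tsub_add_cancel_of_le h.le]
      exact (add_le_add_left h3 _).trans h2
    exact (ENNReal.add_le_add_iff_left (ne_top_of_le_ne_top hB't tsub_le_self)).1 h4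

lemma pointwise_bound (M : MeanFieldModel r) (x : Fin r → ℝ) (hx : x ∈ stdSimplex ℝ (Fin r))
    (l : Fin r → Fin r → ℝ) (h0 : ∀ i j : Fin r, i ≠ j → 0 ≤ l i j)
    (h1 : ∀ i j : Fin r, i ≠ j → (i, j) ∉ M.E → l i j = 0)
    (h2 : ∀ i : Fin r, l i i = -∑ j ∈ Finset.univ.filter (fun j => j ≠ i), l i j)
    (a : ℝ) (ha : 0 < a) (ha1 : a ≤ 1) (i : Fin r) :
    |(∑ j, M.lam j i x * x j) - ∑ j, l j i * x j| ≤
      2 * (a * (M.E.card * |M.Cb|)) + 2 / a * ∑ p ∈ M.E,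
        x p.1 * M.lam p.1 p.2 x * tauStar (l p.1 p.2 / M.lam p.1 p.2 x - 1) := by
  classical
  set d : Fin r → Fin r → ℝ := fun i j => M.lam i j x - l i j with hd
  set h : Fin r × Fin r → ℝ := fun p => if p ∈ M.E then x p.1 * |d p.1 p.2| else 0 with hh
  have hxn : ∀ j, 0 ≤ x j := hx.1
  have hhn : ∀ p, 0 ≤ h p := by
    intro p
    simp only [hh]
    split_ifs
    · exact mul_nonneg (hxn _) (abs_nonneg _)
    · exact le_rfl
  have hdh : ∀ j k, j ≠ k → x j * |d j k| = h (j, k) := by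
    intro j k hjk
    simp only [hh]
    split_ifs with hE
    · rfl
    · simp [hd, h1 j k hjk hE, M.lam_off j k hjk hE]
  have hdd : d i i = -∑ j ∈ Finset.univ.filter (fun j => j ≠ i), d i j := by
    simp only [hd, h2 i, M.lam_diag i, Finset.sum_sub_distrib]
    ring
  have hS : ∑ p, h p = ∑ p ∈ M.E, x p.1 * |d p.1 p.2| := by
    simp [hh, Finset.sum_ite_mem]
  have hS2 : ∑ p, h p = ∑ j, ∑ k, h (j, k) := Fintype.sum_prod_type _
  have e1 : (∑ j, M.lam j i x * x j) - ∑ j, l j i * x j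
      = (∑ j ∈ Finset.univ.filter (fun j => j ≠ i), d j i * x j)
        - ∑ j ∈ Finset.univ.filter (fun j => j ≠ i), d i j * x i := by
    rw [← Finset.sum_sub_distrib]
    have : ∀ j, M.lam j i x * x j - l j i * x j = d j i * x j := by intro j; simp only [hd]; ring
    simp only [this]
    rw [← Finset.sum_filter_add_sum_filter_not Finset.univ (fun j => j ≠ i)]
    have hf : Finset.univ.filter (fun j => ¬ j ≠ i) = {i} := by ext j; simp
    rw [hf, Finset.sum_singleton, hdd, ← Finset.sum_mul]
    ring
  have b1 : |∑ j ∈ Finset.univ.filter (fun j => j ≠ i), d j i * x j| ≤ ∑ p, h p := by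
    refine (Finset.abs_sum_le_sum_abs _ _).trans ?_
    rw [hS2]
    refine (Finset.sum_le_sum (g := fun j => ∑ k, h (j, k)) fun j hj => ?_).trans
      (Finset.sum_le_sum_of_subset_of_nonneg (Finset.filter_subset _ _)
        (fun j _ _ => Finset.sum_nonneg fun k _ => hhn _))
    have hj' : j ≠ i := (Finset.mem_filter.1 hj).2
    rw [abs_mul, abs_of_nonneg (hxn j), mul_comm, hdh j i hj']
    exact Finset.single_le_sum (f := fun k => h (j, k)) (fun k _ => hhn _) (Finset.mem_univ i)
  have b2 : |∑ j ∈ Finset.univ.filter (fun j => j ≠ i), d i j * x i| ≤ ∑ p, h p := by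
    refine (Finset.abs_sum_le_sum_abs _ _).trans ?_
    rw [hS2]
    refine le_trans ?_ (Finset.single_le_sum (f := fun j => ∑ k, h (j, k))
      (fun j _ => Finset.sum_nonneg fun k _ => hhn _) (Finset.mem_univ i))
    refine (Finset.sum_le_sum (g := fun k => h (i, k)) fun j hj => ?_).trans
      (Finset.sum_le_sum_of_subset_of_nonneg (Finset.filter_subset _ _) (fun j _ _ => hhn _))
    have hj' : j ≠ i := (Finset.mem_filter.1 hj).2
    rw [abs_mul, abs_of_nonneg (hxn i), mul_comm, hdh i j hj'.symm]
  have b3 : ∑ p ∈ M.E, x p.1 * |d p.1 p.2| ≤ ∑ p ∈ M.E, (a * |M.Cb| + 1 / a *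
        (x p.1 * M.lam p.1 p.2 x * tauStar (l p.1 p.2 / M.lam p.1 p.2 x - 1))) := by
    refine Finset.sum_le_sum fun p hp => ?_
    have hne : p.1 ≠ p.2 := by
      intro he
      apply M.no_diag p.1
      have : p = (p.1, p.1) := Prod.ext rfl he.symm
      rwa [← this]
    have hlp : 0 < M.lam p.1 p.2 x := M.c_pos.trans_le (M.lam_lower p hp x hx)
    have hlC := lam_le' M hne hx
    have hx1 : x p.1 ≤ 1 := (mem_Icc_of_mem_stdSimplex hx p.1).2
    have ht := tau_abs (l p.1 p.2 / M.lam p.1 p.2 x) a (div_nonneg (h0 _ _ hne) hlp.le) ha ha1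
    have e : |d p.1 p.2| = M.lam p.1 p.2 x * |l p.1 p.2 / M.lam p.1 p.2 x - 1| := by
      rw [← abs_of_pos hlp, ← abs_mul, abs_of_pos hlp, mul_sub, mul_div_cancel₀ _ hlp.ne', mul_one,
        abs_sub_comm]
    rw [e, ← mul_assoc]
    refine (mul_le_mul_of_nonneg_left ht (mul_nonneg (hxn _) hlp.le)).trans ?_
    have q : x p.1 * M.lam p.1 p.2 x ≤ |M.Cb| := by
      calc x p.1 * M.lam p.1 p.2 x ≤ 1 * M.lam p.1 p.2 x := mul_le_mul_of_nonneg_right hx1 hlp.le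
        _ ≤ |M.Cb| := by rw [one_mul]; exact hlC
    rw [mul_add, mul_comm _ a]
    refine add_le_add (mul_le_mul_of_nonneg_left q ha.le) (le_of_eq ?_)
    ring
  rw [Finset.sum_add_distrib, Finset.sum_const, nsmul_eq_mul, ← Finset.mul_sum] at b3
  rw [e1]
  refine (abs_sub _ _).trans ?_
  rw [hS] at b1 b2
  refine (add_le_add (b1.trans b3) (b2.trans b3)).trans (le_of_eq ?_)
  ring

lemma simplex_continuousOn (M : MeanFieldModel r) (μ : ℝ → Fin r → ℝ) (f : Fin r → ℝ → ℝ)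
    (h1 : ∀ T : ℝ, 0 < T → ∀ i : Fin r, IntegrableOn (f i) (Icc 0 T))
    (h2 : ∀ t : ℝ, 0 ≤ t → ∀ i : Fin r, μ t i = μ 0 i - ∫ s in Ioc (0 : ℝ) t, f i s) :
    ContinuousOn μ (Ici 0) := by
  intro t ht
  have hc : ContinuousOn μ (Icc 0 (t + 1)) := by
    rw [continuousOn_pi]
    intro i
    refine ContinuousOn.congr (f := fun t => μ 0 i - ∫ s in Ioc (0 : ℝ) t, f i s)
      (continuousOn_const.sub (intervalIntegral.continuousOn_primitive
      (h1 (t + 1) (by have : (0:ℝ) ≤ t := ht; linarith) i))) (fun s hs => h2 s hs.1 i)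
  refine (hc t ⟨ht, by linarith⟩).mono_of_mem_nhdsWithin ?_
  rw [← Ici_inter_Iic]
  exact inter_mem_nhdsWithin _ (Iic_mem_nhds (by linarith))

lemma incr (μ : ℝ → Fin r → ℝ) (f : Fin r → ℝ → ℝ)
    (h1 : ∀ T : ℝ, 0 < T → ∀ i : Fin r, IntegrableOn (f i) (Icc 0 T))
    (h2 : ∀ t : ℝ, 0 ≤ t → ∀ i : Fin r, μ t i = μ 0 i - ∫ s in Ioc (0 : ℝ) t, f i s)
    (i : Fin r) (a b : ℝ) (ha : 0 ≤ a) (hab : a ≤ b) :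
    IntervalIntegrable (f i) volume a b ∧ μ b i - μ a i = - ∫ s in a..b, f i s := by
  have hi : ∀ c, 0 ≤ c → IntervalIntegrable (f i) volume 0 c := by
    intro c hc
    rw [intervalIntegrable_iff_integrableOn_Ioc_of_le hc]
    exact (h1 (c + 1) (by linarith) i).mono_set
      (Ioc_subset_Icc_self.trans (Icc_subset_Icc_right (by linarith)))
  have hb := ha.trans hab
  refine ⟨(hi a ha).symm.trans (hi b hb), ?_⟩
  rw [h2 a ha, h2 b hb, ← intervalIntegral.integral_of_le ha, ← intervalIntegral.integral_of_le hb,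
    ← intervalIntegral.integral_interval_sub_left (hi b hb) (hi a ha)]
  ring

lemma err_small (M : MeanFieldModel r) (T : ℝ) (hT : 0 < T)
    (μ : ℝ → Fin r → ℝ) (L : ℝ → Fin r → Fin r → ℝ)
    (hL : IsRateMatrix M L) (hODE : SolvesReversedODE L μ)
    (hsimp : ∀ t : ℝ, 0 ≤ t → μ t ∈ stdSimplex ℝ (Fin r))
    {K : NNReal} {G : (Fin r → ℝ) → (Fin r → ℝ)} (hG : LipschitzWith K G)
    (hGe : ∀ x ∈ stdSimplex ℝ (Fin r), ∀ i, G x i = ∑ j, M.lam j i x * x j)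
    (B : ℝ≥0∞) (hBt : B ≠ ⊤) (hB : ∀ m : ℕ, 1 ≤ m → runningCost M μ L (m * T) ≤ B)
    (R : ℝ) (hR : 0 < R) (ε : ℝ) (hε : 0 < ε) :
    ∃ N : ℝ, 0 ≤ N ∧ ∀ τ, N ≤ τ → ∀ t ∈ Icc 0 R, ∀ i,
      |μ (τ + t) i - μ τ i + ∫ s in τ..τ + t, G (μ s) i| ≤ ε := by
  set C : ℝ := M.E.card * |M.Cb| with hC
  have hC0 : 0 ≤ C := by positivity
  set a : ℝ := min 1 (ε / (4 * C * R + 1)) with ha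
  have hap : 0 < a := lt_min one_pos (by positivity)
  have ha1 : a ≤ 1 := min_le_left _ _
  have ha2 : 2 * (a * C) * R ≤ ε / 2 := by
    have : a * (4 * C * R + 1) ≤ ε := by
      rw [← le_div_iff₀ (by positivity)]; exact min_le_right _ _
    nlinarith
  obtain ⟨N, hN, htail⟩ := tail_small _ T hT B hBt hB R hR (ENNReal.ofReal (a * ε / 4))
    (by rw [Ne, ENNReal.ofReal_eq_zero, not_le]; positivity)
  refine ⟨N, hN, fun τ hτ t ht i => ?_⟩
  have hτ0 : 0 ≤ τ := hN.trans hτ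
  have hτt : τ ≤ τ + t := by linarith [ht.1]
  obtain ⟨hint, hinc⟩ := incr μ (fun i s => ∑ j, L s j i * μ s j) hODE.1 hODE.2 i τ (τ + t) hτ0 hτt
  have hμc : ContinuousOn μ (Ici 0) :=
    simplex_continuousOn M μ (fun i s => ∑ j, L s j i * μ s j) hODE.1 hODE.2
  have hGi : IntervalIntegrable (fun s => G (μ s) i) volume τ (τ + t) := by
    apply ContinuousOn.intervalIntegrable
    rw [uIcc_of_le hτt]
    have : ContinuousOn (fun s => G (μ s)) (Ici 0) := hG.continuous.comp_continuousOn hμc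
    exact ((continuous_apply i).comp_continuousOn this).mono
      (fun s hs => show (0:ℝ) ≤ s from hτ0.trans hs.1)
  rw [hinc, neg_add_eq_sub, ← intervalIntegral.integral_sub hGi hint,
    intervalIntegral.integral_of_le hτt]
  rw [← ENNReal.ofReal_le_ofReal_iff hε.le, ← Real.enorm_eq_ofReal_abs]
  refine (enorm_integral_le_lintegral_enorm _).trans ?_
  set c : ℝ → ℝ := fun s => ∑ p ∈ M.E,
    μ s p.1 * M.lam p.1 p.2 (μ s) * tauStar (L s p.1 p.2 / M.lam p.1 p.2 (μ s) - 1) with hc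
  have hbd : ∀ s ∈ Ioc τ (τ + t), ‖G (μ s) i - ∑ j, L s j i * μ s j‖ₑ ≤
      ENNReal.ofReal (2 * (a * C)) + ENNReal.ofReal (2 / a) * ENNReal.ofReal (c s) := by
    intro s hs
    have hs0 : 0 ≤ s := by linarith [hs.1]
    rw [hGe _ (hsimp s hs0), Real.enorm_eq_ofReal_abs, ← ENNReal.ofReal_mul (by positivity)]
    refine (ENNReal.ofReal_le_ofReal (pointwise_bound M (μ s) (hsimp s hs0) (L s) (hL.2.1 s)
      (hL.2.2.1 s) (hL.2.2.2 s) a hap ha1 i)).trans ENNReal.ofReal_add_le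
  refine (setLIntegral_mono' measurableSet_Ioc hbd).trans ?_
  rw [lintegral_add_left measurable_const, lintegral_const_mul' _ _ ENNReal.ofReal_ne_top,
    setLIntegral_const, Real.volume_Ioc, add_sub_cancel_left,
    ← ENNReal.ofReal_mul (by positivity)]
  have h1 : ENNReal.ofReal (2 * (a * C) * t) ≤ ENNReal.ofReal (ε / 2) :=
    ENNReal.ofReal_le_ofReal
      ((mul_le_mul_of_nonneg_left ht.2 (by positivity)).trans ha2)
  have h2 : ENNReal.ofReal (2 / a) * ∫⁻ s in Ioc τ (τ + t), ENNReal.ofReal (c s)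
      ≤ ENNReal.ofReal (ε / 2) := by
    have : ∫⁻ s in Ioc τ (τ + t), ENNReal.ofReal (c s) ≤ ENNReal.ofReal (a * ε / 4) :=
      (lintegral_mono_set (Ioc_subset_Ioc_right (by linarith [ht.2]))).trans (htail τ hτ)
    refine (mul_le_mul_right this _).trans ?_
    rw [← ENNReal.ofReal_mul (by positivity)]
    refine ENNReal.ofReal_le_ofReal (le_of_eq ?_)
    field_simp
    norm_num
  refine (add_le_add h1 h2).trans ?_
  rw [← ENNReal.ofReal_add (by positivity) (by positivity), add_halves]

lemma zeta_pos (M : MeanFieldModel r) (ζ : ℝ → Fin r → ℝ)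
    (hs : ∀ t, 0 ≤ t → ζ t ∈ stdSimplex ℝ (Fin r))
    (hd : ∀ t, 0 ≤ t → ∀ i, HasDerivAt (fun t => ζ t i) (- ∑ j, M.lam j i (ζ t) * ζ t j) t) :
    ∀ t, 0 ≤ t → ∀ i, 0 < ζ t i := by
  classical
  set K0 : ℝ := r * |M.Cb| with hK0
  have hdiag : ∀ t, 0 ≤ t → ∀ i, - M.lam i i (ζ t) ≤ K0 := by
    intro t ht i
    rw [M.lam_diag, neg_neg]
    calc ∑ j ∈ Finset.univ.filter (fun j => j ≠ i), M.lam i j (ζ t)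
        ≤ ∑ j ∈ Finset.univ.filter (fun j => j ≠ i), |M.Cb| :=
          Finset.sum_le_sum fun j hj => lam_le' M (Finset.mem_filter.1 hj).2.symm (hs t ht)
      _ ≤ ∑ j : Fin r, |M.Cb| := Finset.sum_le_sum_of_subset_of_nonneg (Finset.filter_subset _ _)
          (fun _ _ _ => abs_nonneg _)
      _ = K0 := by simp [hK0]
  have hsplit : ∀ t i, ∑ j, M.lam j i (ζ t) * ζ t j =
      M.lam i i (ζ t) * ζ t i + ∑ j ∈ Finset.univ.erase i, M.lam j i (ζ t) * ζ t j := by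
    intro t i
    exact (Finset.add_sum_erase _ (fun j => M.lam j i (ζ t) * ζ t j) (Finset.mem_univ i)).symm
  have hterm : ∀ t, 0 ≤ t → ∀ i, ∀ j ∈ Finset.univ.erase i, 0 ≤ M.lam j i (ζ t) * ζ t j :=
    fun t ht i j hj => mul_nonneg (lam_nonneg' M (Finset.ne_of_mem_erase hj) (hs t ht)) ((hs t ht).1 j)
  have hanti : ∀ i, AntitoneOn (fun t => Real.exp (-K0 * t) * ζ t i) (Ici 0) := by
    intro i
    have hder : ∀ t, 0 ≤ t → HasDerivAt (fun t => Real.exp (-K0 * t) * ζ t i)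
        (Real.exp (-K0 * t) * (-K0 * 1) * ζ t i +
          Real.exp (-K0 * t) * (- ∑ j, M.lam j i (ζ t) * ζ t j)) t := fun t ht =>
      (((hasDerivAt_id t).const_mul (-K0)).exp).mul (hd t ht i)
    refine antitoneOn_of_deriv_nonpos (convex_Ici 0)
      (fun t ht => (hder t ht).continuousAt.continuousWithinAt) ?_ ?_
    · intro t ht
      rw [interior_Ici] at ht
      exact (hder t (le_of_lt ht)).differentiableAt.differentiableWithinAt
    · intro t ht
      rw [interior_Ici] at ht
      have ht' : 0 ≤ t := le_of_lt ht
      rw [(hder t ht').deriv, hsplit]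
      have h1 := Finset.sum_nonneg (hterm t ht' i)
      have h2 := mul_le_mul_of_nonneg_right (hdiag t ht' i) ((hs t ht').1 i)
      have h3 := Real.exp_pos (-K0 * t)
      have : Real.exp (-K0 * t) * (-K0 * ζ t i - M.lam i i (ζ t) * ζ t i -
        ∑ j ∈ Finset.univ.erase i, M.lam j i (ζ t) * ζ t j) ≤ 0 :=
        mul_nonpos_of_nonneg_of_nonpos h3.le (by linarith)
      linarith
  have hstay : ∀ i t1, 0 ≤ t1 → ζ t1 i = 0 → ∀ t, t1 ≤ t → ζ t i = 0 := by
    intro i t1 h1 hz t ht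
    have h := hanti i (show t1 ∈ Ici 0 from h1) (show t ∈ Ici 0 from h1.trans ht) ht
    simp only [hz, mul_zero] at h
    have h2 := Real.exp_pos (-K0 * t)
    have h3 := (hs t (h1.trans ht)).1 i
    by_contra hne
    have := mul_pos h2 (lt_of_le_of_ne h3 (Ne.symm hne))
    linarith
  have hpred : ∀ i j, (j, i) ∈ M.E → (∃ t, 0 ≤ t ∧ ζ t i = 0) → ∃ t, 0 ≤ t ∧ ζ t j = 0 := by
    rintro i j hE ⟨t, ht, hz⟩
    have hne : j ≠ i := by rintro rfl; exact M.no_diag _ hE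
    refine ⟨t + 1, by linarith, ?_⟩
    have ht1 : 0 ≤ t + 1 := by linarith
    have hev : (fun s => ζ s i) =ᶠ[nhds (t + 1)] fun _ => (0:ℝ) := by
      filter_upwards [Ioi_mem_nhds (show t < t + 1 by linarith)] with s hs'
      exact hstay i t ht hz s (le_of_lt hs')
    have h0 := (hd (t+1) ht1 i).unique ((hasDerivAt_const (t+1) (0:ℝ)).congr_of_eventuallyEq hev)
    rw [hsplit, hev.eq_of_nhds, mul_zero, zero_add, neg_eq_zero,
      Finset.sum_eq_zero_iff_of_nonneg (hterm _ ht1 i)] at h0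
    have h1 := h0 j (Finset.mem_erase.2 ⟨hne, Finset.mem_univ j⟩)
    have h2 : 0 < M.lam j i (ζ (t+1)) := M.c_pos.trans_le (M.lam_lower _ hE _ (hs _ ht1))
    exact (mul_eq_zero.1 h1).resolve_left h2.ne'
  intro t ht i
  by_contra hcon
  have hz : ζ t i = 0 := le_antisymm (not_lt.1 hcon) ((hs t ht).1 i)
  have hall : ∀ k, ∃ t, 0 ≤ t ∧ ζ t k = 0 := by
    intro k
    induction M.irreducible k i using Relation.ReflTransGen.head_induction_on with
    | refl => exact ⟨t, ht, hz⟩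
    | head h' _ ih => exact hpred _ _ h' ih
  choose tk htk hzk using hall
  have hsum : 0 ≤ ∑ k, tk k := Finset.sum_nonneg fun k _ => htk k
  have h1 := (hs _ hsum).2
  have h2 : ∀ k, ζ (∑ k, tk k) k = 0 := fun k => hstay k (tk k) (htk k) (hzk k) _
    (Finset.single_le_sum (fun k _ => htk k) (Finset.mem_univ k))
  simp [h2] at h1

lemma sum_lam (M : MeanFieldModel r) (j : Fin r) (x : Fin r → ℝ) : ∑ i, M.lam j i x = 0 := by
  classical
  rw [← Finset.sum_filter_add_sum_filter_not Finset.univ (fun i => i ≠ j)]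
  have hf : Finset.univ.filter (fun i => ¬ i ≠ j) = {j} := by ext j; simp
  rw [hf, Finset.sum_singleton, M.lam_diag]
  ring

lemma eta_eq (M : MeanFieldModel r) (η ζ : ℝ → Fin r → ℝ) (hη : IsReversedMVSolution M η)
    {K : NNReal} {G : (Fin r → ℝ) → (Fin r → ℝ)} (hG : LipschitzWith K G)
    (hGe : ∀ x ∈ stdSimplex ℝ (Fin r), ∀ i, G x i = ∑ j, M.lam j i x * x j)
    (hs : ∀ t, 0 ≤ t → ζ t ∈ stdSimplex ℝ (Fin r))
    (hd : ∀ t, 0 ≤ t → HasDerivAt ζ (- G (ζ t)) t) (h0 : η 0 = ζ 0) :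
    ∀ t, 0 ≤ t → η t = ζ t := by
  have hpos := zeta_pos M ζ hs (fun t ht i => by
    have := (hasDerivAt_pi.1 (hd t ht)) i
    rw [Pi.neg_apply, hGe _ (hs t ht)] at this
    exact this)
  have hηc : ContinuousOn η (Ici 0) :=
    simplex_continuousOn M η (fun i s => ∑ j, M.lam j i (η s) * η s j) hη.1 hη.2
  have hinc := incr η (fun i s => ∑ j, M.lam j i (η s) * η s j) hη.1 hη.2
  have hsum : ∀ t, 0 ≤ t → ∑ i, η t i = 1 := by
    intro t ht
    have h1 : ∑ i, (η t i - η 0 i) = 0 := by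
      rw [Finset.sum_congr rfl (fun i _ => (hinc i 0 t le_rfl ht).2), Finset.sum_neg_distrib,
        ← intervalIntegral.integral_finsetSum (fun i _ => (hinc i 0 t le_rfl ht).1)]
      have : ∀ s, ∑ i, ∑ j, M.lam j i (η s) * η s j = 0 := by
        intro s
        rw [Finset.sum_comm]
        simp only [← Finset.sum_mul, sum_lam, zero_mul, Finset.sum_const_zero]
      simp [this]
    rw [Finset.sum_sub_distrib, h0, (hs 0 le_rfl).2] at h1
    linarith
  have hζc : ContinuousOn ζ (Ici 0) := fun t ht => (hd t ht).continuousAt.continuousWithinAt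
  have hGc := hG.continuous
  intro t ht
  suffices h : Icc 0 t ⊆ {t | η t = ζ t} from h ⟨ht, le_rfl⟩
  apply IsClosed.Icc_subset_of_forall_exists_gt
  · have hsub : Icc 0 t ⊆ Ici (0:ℝ) := Icc_subset_Ici_self
    have := (hηc.mono hsub).prodMk (hζc.mono hsub) |>.preimage_isClosed_of_isClosed isClosed_Icc
      (isClosed_diagonal (X := Fin r → ℝ))
    convert this using 1
    ext s
    simp [and_comm]
  · exact h0
  · rintro x ⟨hx, hx0, hxt⟩ y hy
    have hx : η x = ζ x := hx
    have hy : x < y := hy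
    -- near x, eta is positive
    have hev : ∀ᶠ s in nhdsWithin x (Ici 0), ∀ i, 0 < η s i := by
      rw [eventually_all]
      intro i
      have hci : ContinuousWithinAt (fun s => η s i) (Ici 0) x :=
        (continuous_apply i).continuousAt.comp_continuousWithinAt (hηc x hx0)
      refine hci.eventually (lt_mem_nhds ?_)
      simp only [hx]
      exact hpos x hx0 i
    obtain ⟨δ, hδ, hev⟩ := Metric.mem_nhdsWithin_iff.1 hev
    set b := min y (x + δ / 2) with hb
    have hxb : x < b := lt_min hy (by linarith)
    have hbδ : b ≤ x + δ / 2 := min_le_right _ _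
    have hmem : ∀ s ∈ Icc x b, η s ∈ stdSimplex ℝ (Fin r) := by
      intro s hs'
      have hs0 : 0 ≤ s := hx0.trans hs'.1
      refine ⟨fun i => (hev ⟨?_, hs0⟩ i).le, hsum s hs0⟩
      rw [Metric.mem_ball, Real.dist_eq, abs_of_nonneg (by linarith [hs'.1])]
      linarith [hs'.2]
    set η' : ℝ → Fin r → ℝ := fun s => η (max x (min s b)) with hη'
    have hη'c : Continuous η' := by
      refine hηc.comp_continuous (by fun_prop) (fun s => ?_)
      exact hx0.trans (le_max_left _ _)
    have hη'e : ∀ s ∈ Icc x b, η' s = η s := by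
      intro s hs'
      simp only [hη']
      rw [min_eq_left hs'.2, max_eq_right hs'.1]
    set Q : ℝ → Fin r → ℝ := fun s => η x - ∫ q in x..s, G (η' q) with hQ
    have hQd : ∀ s, HasDerivAt Q (- G (η' s)) s := fun s =>
      ((hGc.comp hη'c).integral_hasStrictDerivAt x s).hasDerivAt.const_sub _
    have hQe : ∀ s ∈ Icc x b, Q s = η s := by
      intro s hs'
      funext i
      have h1 := (hinc i x s hx0 hs'.1).2
      have h2 : (∫ q in x..s, G (η' q)) i = ∫ q in x..s, G (η' q) i :=
        ((ContinuousLinearMap.proj (R := ℝ) (φ := fun _ : Fin r => ℝ) i).intervalIntegral_comp_comm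
          ((hGc.comp hη'c).intervalIntegrable x s)).symm
      have h3 : ∫ q in x..s, G (η' q) i = ∫ q in x..s, ∑ j, M.lam j i (η q) * η q j := by
        refine intervalIntegral.integral_congr (fun q hq => ?_)
        rw [uIcc_of_le hs'.1] at hq
        have hq' : q ∈ Icc x b := ⟨hq.1, hq.2.trans hs'.2⟩
        rw [hη'e q hq', hGe _ (hmem q hq')]
      simp only [hQ, Pi.sub_apply]
      rw [h2, h3]
      linarith
    have huniq := ODE_solution_unique (v := fun _ x => - G x) (K := K) (f := Q) (g := ζ) (a := x)
      (b := b) (fun _ => hG.neg) (fun s _ => (hQd s).continuousAt.continuousWithinAt)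
      (fun s hs' => by
        have hs2 : s ∈ Icc x b := ⟨hs'.1, hs'.2.le⟩
        have := (hQd s).hasDerivWithinAt (s := Ici s)
        rw [hη'e s hs2, ← hQe s hs2] at this
        exact this)
      (hζc.mono (fun s hs' => show (0:ℝ) ≤ s from hx0.trans hs'.1))
      (fun s hs' => (hd s (hx0.trans hs'.1)).hasDerivWithinAt)
      (by simp [hQ, hx])
    refine ⟨b, ?_, hxb, min_le_left _ _⟩
    have hbm : b ∈ Icc x b := ⟨hxb.le, le_rfl⟩
    exact (hQe b hbm).symm.trans (huniq hbm)

/-- the ω-limit set of an optimal infinite-horizon reversed-time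
path is positively invariant for the time-reversed McKean–Vlasov equation. -/
theorem stmt10 (r : ℕ) (hr : 0 < r) (M : MeanFieldModel r) (T : ℝ) (hT : 0 < T)
    (s : (Fin r → ℝ) → ℝ)
    (hs_nonneg : ∀ ξ ∈ stdSimplex ℝ (Fin r), 0 ≤ s ξ)
    (hs_lsc : LowerSemicontinuousOn s (stdSimplex ℝ (Fin r)))
    (hDPE : SatisfiesDPE M s)
    (hzero : ∃ ν ∈ stdSimplex ℝ (Fin r), s ν = 0)
    (μ : ℝ → Fin r → ℝ) (L : ℝ → Fin r → Fin r → ℝ)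
    (hL : IsRateMatrix M L) (hODE : SolvesReversedODE L μ)
    (hsimp : ∀ t : ℝ, 0 ≤ t → μ t ∈ stdSimplex ℝ (Fin r))
    (heq : ∀ m : ℕ, 1 ≤ m →
      ENNReal.ofReal (s (μ 0)) =
        ENNReal.ofReal (s (μ ((m : ℝ) * T))) + runningCost M μ L ((m : ℝ) * T)) :
    ∀ η : ℝ → Fin r → ℝ, IsReversedMVSolution M η → η 0 ∈ omegaSet μ →
      ∀ t : ℝ, 0 ≤ t → η t ∈ omegaSet μ := by
  intro η hη hη0
  obtain ⟨K, G, hK, hG, hGe⟩ := exists_ext M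
  have hBt : ENNReal.ofReal (s (μ 0)) ≠ ⊤ := ENNReal.ofReal_ne_top
  have hB : ∀ m : ℕ, 1 ≤ m → runningCost M μ L (m * T) ≤ ENNReal.ofReal (s (μ 0)) :=
    fun m hm => by rw [heq m hm]; exact le_add_self
  have herr := err_small M T hT μ L hL hODE hsimp hG hGe _ hBt hB
  have hμc : ContinuousOn μ (Ici 0) :=
    simplex_continuousOn M μ (fun i s => ∑ j, L s j i * μ s j) hODE.1 hODE.2
  -- the sequence of times
  have hseq : ∀ n : ℕ, ∃ t : ℝ, (n : ℝ) + 1 ≤ t ∧ dist (μ t) (η 0) < 1 / ((n : ℝ) + 1) := by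
    intro n
    have h1 : η 0 ∈ closure (μ '' Ici ((n : ℝ) + 1)) := by
      have := hη0
      rw [omegaSet, mem_iInter₂] at this
      exact this _ (show (0:ℝ) < n + 1 by positivity)
    obtain ⟨y, ⟨t, ht, rfl⟩, hy⟩ := Metric.mem_closure_iff.1 h1 (1 / ((n : ℝ) + 1)) (by positivity)
    exact ⟨t, ht, by rwa [dist_comm]⟩
  choose tn htn hdn using hseq
  have htn0 : ∀ n, 0 ≤ tn n := fun n => by
    have := htn n
    have : (0:ℝ) ≤ n := by positivity
    linarith [htn n]
  have htop : Tendsto tn atTop atTop :=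
    tendsto_atTop_mono (fun n => by linarith [htn n]) tendsto_natCast_atTop_atTop
  have hlim : Tendsto (fun n => μ (tn n)) atTop (nhds (η 0)) := by
    rw [tendsto_iff_dist_tendsto_zero]
    exact squeeze_zero (fun _ => dist_nonneg) (fun n => (hdn n).le)
      tendsto_one_div_add_atTop_nhds_zero_nat
  set w : ℕ → ℝ → Fin r → ℝ := fun n t => μ (max (tn n + t) 0) with hw
  have hwe : ∀ n t, 0 ≤ t → w n t = μ (tn n + t) := by
    intro n t ht
    simp only [hw]
    rw [max_eq_left (add_nonneg (htn0 n) ht)]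
  have hwc : ∀ n, Continuous (w n) := fun n =>
    hμc.comp_continuous (by fun_prop) (fun t => show (0:ℝ) ≤ _ from le_max_right _ _)
  have hwb : ∀ n t, ‖w n t‖ ≤ 1 := by
    intro n t
    rw [pi_norm_le_iff_of_nonneg zero_le_one]
    intro i
    have := mem_Icc_of_mem_stdSimplex (hsimp (max (tn n + t) 0) (le_max_right _ _)) i
    rw [Real.norm_eq_abs, abs_of_nonneg this.1]
    exact this.2
  have hwx : Tendsto (fun n => w n 0) atTop (nhds (η 0)) := by
    refine hlim.congr (fun n => ?_)
    rw [hwe n 0 le_rfl, add_zero]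
  obtain ⟨ζ, hζ0, hζl, hζd⟩ := limit_exists hK hG w hwc hwb (η 0) hwx (by
    intro R hR ε hε
    obtain ⟨N, hN, h⟩ := herr R hR ε hε
    filter_upwards [htop.eventually_ge_atTop N] with n hn t ht
    rw [pi_norm_le_iff_of_nonneg hε.le]
    intro i
    have h1 := h (tn n) hn t ht i
    have h2 : (∫ q in (0:ℝ)..t, G (w n q)) i = ∫ q in (0:ℝ)..t, G (w n q) i :=
      ((ContinuousLinearMap.proj (R := ℝ) (φ := fun _ : Fin r => ℝ) i).intervalIntegral_comp_comm
        ((hG.continuous.comp (hwc n)).intervalIntegrable 0 t)).symm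
    have h3 : ∫ q in (0:ℝ)..t, G (w n q) i = ∫ q in tn n..tn n + t, G (μ q) i := by
      have h4 := intervalIntegral.integral_comp_add_left (a := 0) (b := t)
        (fun q => G (μ q) i) (tn n)
      rw [add_zero] at h4
      rw [← h4]
      refine intervalIntegral.integral_congr (fun q hq => ?_)
      rw [uIcc_of_le ht.1] at hq
      rw [hwe n q hq.1]
    rw [Real.norm_eq_abs, Pi.add_apply, Pi.sub_apply, h2, h3, hwe n t ht.1, hwe n 0 le_rfl,
      add_zero]
    exact h1)
  have hζl' : ∀ t, 0 ≤ t → Tendsto (fun n => μ (tn n + t)) atTop (nhds (ζ t)) := by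
    intro t ht
    exact (hζl t ht).congr (fun n => hwe n t ht)
  have hζs : ∀ t, 0 ≤ t → ζ t ∈ stdSimplex ℝ (Fin r) := fun t ht =>
    (isClosed_stdSimplex ℝ (Fin r)).mem_of_tendsto (hζl' t ht)
      (Eventually.of_forall fun n => hsimp _ (add_nonneg (htn0 n) ht))
  intro t ht
  rw [eta_eq M η ζ hη hG hGe hζs hζd hζ0.symm t ht, omegaSet, mem_iInter₂]
  intro q hq
  refine mem_closure_of_tendsto (hζl' t ht) ?_
  filter_upwards [htop.eventually_ge_atTop q] with n hn
  exact ⟨tn n + t, by simp only [mem_Ici]; linarith, rfl⟩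
end
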